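/- arXiv:2109.09402 — 4 statements merged into one kernel-verified Lean document; each statement's English description precedes it below -/
import Mathlib

section
/- Let φ ∈ 𝒮(ℝ^n) be a Schwartz function and u ∈ 𝒮'(ℝ^n) a tempered distribution such that u = u * φ. Then u is a smooth function, and for every p ∈ (0,∞] there is a constant C > 0 (depending only on φ, p, n) such that |u(x)| ≤ C (1 + |x − y|)^{n/p} (M_p u)(y) for all x, y ∈ ℝ^n and all such u, where M_p is the p-maximal function. -/
open MeasureTheory ENNReal Metric

/-- The `p`-maximal function: `(M_p u)(y) = sup_B (⨍_B |u|^p)^{1/p}`, the supremum running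
over all balls `B` containing `y`; for `p = ∞` it is the constant `‖u‖_{L^∞}`. -/
noncomputable def maximalFn {n : ℕ} (p : ℝ≥0∞) (u : EuclideanSpace ℝ (Fin n) → ℂ)
    (y : EuclideanSpace ℝ (Fin n)) : ℝ≥0∞ :=
  if p = ∞ then eLpNorm u ∞ volume
  else ⨆ (c : EuclideanSpace ℝ (Fin n)) (r : ℝ) (_ : 0 < r) (_ : y ∈ ball c r),
    ((∫⁻ z in ball c r, (‖u z‖₊ : ℝ≥0∞) ^ p.toReal) / volume (ball c r)) ^ (1 / p.toReal)

theorem schwartz_decay {E F : Type} [NormedAddCommGroup E] [NormedSpace ℝ E]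
    [NormedAddCommGroup F] [NormedSpace ℝ F] (ψ : SchwartzMap E F) (N : ℕ) :
    ∃ C : ℝ, 0 < C ∧ ∀ x, ‖ψ x‖ ≤ C * ((1 + ‖x‖) ^ N)⁻¹ := by
  have h := fun x => SchwartzMap.one_add_le_sup_seminorm_apply (𝕜 := ℝ) (m := (N, 0)) (k := N)
    (n := 0) le_rfl le_rfl ψ x
  set D := 2 ^ (N, 0).1 * (Finset.Iic (N, 0)).sup (fun m : ℕ × ℕ => SchwartzMap.seminorm ℝ m.1 m.2) ψ
  refine ⟨max D 1, by positivity, fun x => ?_⟩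
  rw [← div_eq_mul_inv, le_div_iff₀ (by positivity), mul_comm]
  have := h x
  rw [norm_iteratedFDeriv_zero] at this
  exact this.trans (le_max_left _ _)

theorem integrable_ker {n : ℕ} (x : EuclideanSpace ℝ (Fin n)) :
    Integrable (fun y => ((1 + dist x y) ^ (n + 1))⁻¹) := by
  have h : Integrable (fun y : EuclideanSpace ℝ (Fin n) => (1 + ‖y‖) ^ (-((n + 1 : ℕ) : ℝ))) :=
    integrable_one_add_norm (by simp)
  have := h.comp_sub_left x
  refine this.congr (Filter.Eventually.of_forall fun y => ?_)
  simp only [← dist_eq_norm]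
  rw [Real.rpow_neg (by positivity), Real.rpow_natCast]

/-- key pointwise bound for differentiation under the integral -/
theorem conv_bound {n : ℕ} {F : Type} [NormedAddCommGroup F] [NormedSpace ℝ F]
    (ψ : SchwartzMap (EuclideanSpace ℝ (Fin n)) F)
    (u : EuclideanSpace ℝ (Fin n) → ℂ) (A : ℝ) (k : ℕ) (hA : ∀ x, ‖u x‖ ≤ A * (1 + ‖x‖) ^ k)
    (x₀ : EuclideanSpace ℝ (Fin n)) :
    ∃ D : ℝ, ∀ y, ∀ x ∈ ball x₀ 1, ‖u y‖ * ‖ψ (x - y)‖ ≤ D * ((1 + dist x₀ y) ^ (n + 1))⁻¹ := by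
  obtain ⟨C, hC, h⟩ := schwartz_decay ψ (k + (n + 1))
  have hA0 : 0 ≤ A := by
    have := (norm_nonneg _).trans (hA 0)
    simpa using this
  refine ⟨A * (1 + ‖x₀‖) ^ k * C * 2 ^ (k + (n + 1)), fun y x hx => ?_⟩
  have h1 : 1 + ‖y‖ ≤ (1 + ‖x₀‖) * (1 + dist x₀ y) := by
    have : ‖y‖ ≤ ‖x₀‖ + dist x₀ y := by
      rw [dist_comm, dist_eq_norm]; exact norm_le_norm_add_norm_sub' y x₀
    nlinarith [norm_nonneg x₀, dist_nonneg (x := x₀) (y := y), mul_nonneg (norm_nonneg x₀) (dist_nonneg (x := x₀) (y := y))]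
  have h2 : 1 + dist x₀ y ≤ 2 * (1 + ‖x - y‖) := by
    rw [← dist_eq_norm]
    have := dist_triangle x₀ x y
    rw [mem_ball, dist_comm] at hx
    linarith [dist_nonneg (x := x) (y := y)]
  have h3 : ((1 + ‖x - y‖) ^ (k + (n + 1)))⁻¹ ≤ 2 ^ (k + (n+1)) * ((1 + dist x₀ y) ^ (k + (n + 1)))⁻¹ := by
    rw [← div_eq_mul_inv, inv_eq_one_div, div_le_div_iff₀ (by positivity) (by positivity), one_mul, ← mul_pow]
    gcongr
  calc ‖u y‖ * ‖ψ (x - y)‖ ≤ (A * ((1 + ‖x₀‖) * (1 + dist x₀ y)) ^ k) *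
        (C * (2 ^ (k + (n+1)) * ((1 + dist x₀ y) ^ (k + (n + 1)))⁻¹)) := by
        gcongr
        · exact (hA y).trans (by gcongr)
        · exact (h _).trans (by gcongr)
    _ = _ := by
      have : (1 + dist x₀ y) ≠ 0 := by positivity
      rw [pow_add (1 + dist x₀ y), mul_inv, mul_pow]
      field_simp

theorem conv_contDiff {n : ℕ} (u : EuclideanSpace ℝ (Fin n) → ℂ) (hu : Continuous u)
    (A : ℝ) (k : ℕ) (hA : ∀ x, ‖u x‖ ≤ A * (1 + ‖x‖) ^ k) (m : ℕ) :
    ∀ {F : Type} [NormedAddCommGroup F] [NormedSpace ℝ F] [NormedSpace ℂ F]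
      (ψ : SchwartzMap (EuclideanSpace ℝ (Fin n)) F),
      ContDiff ℝ m (fun x => ∫ y, u y • ψ (x - y)) := by
  induction m with
  | zero =>
    intro F _ _ _ ψ
    simp only [Nat.cast_zero, contDiff_zero]
    refine continuous_iff_continuousAt.2 fun x₀ => ?_
    obtain ⟨D, hD⟩ := conv_bound ψ u A k hA x₀
    refine continuousAt_of_dominated (bound := fun y => D * ((1 + dist x₀ y) ^ (n + 1))⁻¹) ?_ ?_ ?_ ?_
    · refine Filter.Eventually.of_forall fun x => Continuous.aestronglyMeasurable ?_
      exact hu.smul (ψ.continuous.comp (by fun_prop))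
    · filter_upwards [ball_mem_nhds x₀ one_pos] with x hx
      refine Filter.Eventually.of_forall fun y => ?_
      rw [norm_smul]; exact hD y x hx
    · exact (integrable_ker x₀).const_mul D
    · refine Filter.Eventually.of_forall fun y => Continuous.continuousAt ?_
      exact (ψ.continuous.comp (by fun_prop)).const_smul _
  | succ m ih =>
    intro F _ _ _ ψ
    push_cast
    rw [contDiff_succ_iff_hasFDerivAt]
    refine ⟨fun x => ∫ y, u y • (SchwartzMap.fderivCLM ℝ _ _ ψ) (x - y), ih _, fun x₀ => ?_⟩
    obtain ⟨D, hD⟩ := conv_bound (SchwartzMap.fderivCLM ℝ _ _ ψ) u A k hA x₀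
    obtain ⟨D', hD'⟩ := conv_bound ψ u A k hA x₀
    refine hasFDerivAt_integral_of_dominated_of_fderiv_le
      (F' := fun x y => u y • (SchwartzMap.fderivCLM ℝ _ _ ψ) (x - y))
      (bound := fun y => D * ((1 + dist x₀ y) ^ (n + 1))⁻¹) (ball_mem_nhds x₀ one_pos) ?_ ?_ ?_ ?_ ?_ ?_
    · refine Filter.Eventually.of_forall fun x => Continuous.aestronglyMeasurable ?_
      exact hu.smul (ψ.continuous.comp (by fun_prop))
    · refine ((integrable_ker x₀).const_mul D').mono' ?_ ?_
      · exact (hu.smul (ψ.continuous.comp (by fun_prop))).aestronglyMeasurable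
      · refine Filter.Eventually.of_forall fun y => ?_
        rw [norm_smul]; exact hD' y x₀ (mem_ball_self one_pos)
    · exact (hu.smul ((SchwartzMap.continuous _).comp (by fun_prop))).aestronglyMeasurable
    · refine Filter.Eventually.of_forall fun y x hx => ?_
      rw [norm_smul]; exact hD y x hx
    · exact (integrable_ker x₀).const_mul D
    · refine Filter.Eventually.of_forall fun y x hx => ?_
      have h := (ψ.differentiableAt (x := x - y)).hasFDerivAt
      have h2 : HasFDerivAt (fun x => ψ (x - y)) (fderiv ℝ ψ (x - y)) x := by
        have := h.comp x ((hasFDerivAt_id x).sub_const y)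
        simp only [ContinuousLinearMap.comp_id] at this
        exact this
      exact h2.const_smul (u y)

/-- the integral over a ball is controlled by the maximal function -/
theorem ball_le_max {n : ℕ} (p : ℝ≥0∞) (hp : 0 < p) (hp' : p ≠ ∞)
    (u : EuclideanSpace ℝ (Fin n) → ℂ) (c y : EuclideanSpace ℝ (Fin n)) (r : ℝ) (hr : 0 < r)
    (hy : y ∈ ball c r) :
    ∫⁻ z in ball c r, ‖u z‖ₑ ^ p.toReal ≤ maximalFn p u y ^ p.toReal * volume (ball c r) := by
  have hq : 0 < p.toReal := ENNReal.toReal_pos hp.ne' hp'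
  have h : ((∫⁻ z in ball c r, ‖u z‖ₑ ^ p.toReal) / volume (ball c r)) ^ (1 / p.toReal)
      ≤ maximalFn p u y := by
    rw [maximalFn, if_neg hp']
    exact le_iSup₂_of_le c r (le_iSup₂_of_le hr hy le_rfl)
  rw [one_div, ENNReal.rpow_inv_le_iff hq] at h
  rwa [ENNReal.div_le_iff (measure_ball_pos volume c hr).ne' measure_ball_lt_top.ne] at h

/-- dyadic domination of the kernel -/
theorem ker_le_dyadic {n : ℕ} (x z : EuclideanSpace ℝ (Fin n)) :
    ENNReal.ofReal (((1 + dist x z) ^ (n + 1))⁻¹) ≤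
      ∑' j : ℕ, (ball x (2 ^ j)).indicator
        (fun _ => ENNReal.ofReal (2 ^ (n + 1) * ((2 ^ j) ^ (n + 1))⁻¹)) z := by
  have hex : ∃ j : ℕ, dist x z < 2 ^ j := pow_unbounded_of_one_lt _ one_lt_two
  classical
  refine le_trans ?_ (ENNReal.le_tsum (Nat.find hex))
  have hj := Nat.find_spec hex
  have hmin := fun m => Nat.find_min hex (m := m)
  generalize Nat.find hex = j at hj hmin
  rw [Set.indicator_of_mem (by rwa [mem_ball, dist_comm])]
  apply ENNReal.ofReal_le_ofReal
  rw [← div_eq_mul_inv, inv_eq_one_div, div_le_div_iff₀ (by positivity) (by positivity), one_mul,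
    ← mul_pow]
  gcongr
  cases j with
  | zero => simp; linarith [dist_nonneg (x := x) (y := z)]
  | succ m =>
    have := hmin m (Nat.lt_succ_self m)
    rw [pow_succ]
    linarith

theorem int_le_max {n : ℕ} (p : ℝ≥0∞) (hp : 0 < p) (hp' : p ≠ ∞)
    (u : EuclideanSpace ℝ (Fin n) → ℂ) (hu : Continuous u) (x y : EuclideanSpace ℝ (Fin n)) :
    ∫⁻ z, ‖u z‖ₑ ^ p.toReal * ENNReal.ofReal (((1 + dist x z) ^ (n + 1))⁻¹) ≤
      (ENNReal.ofReal (2 ^ (n + 1)) * volume (ball (0 : EuclideanSpace ℝ (Fin n)) 1) * 2)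
        * ENNReal.ofReal ((1 + dist x y) ^ n) * maximalFn p u y ^ p.toReal := by
  set M := maximalFn p u y ^ p.toReal
  set ω := volume (ball (0 : EuclideanSpace ℝ (Fin n)) 1)
  have hm : Measurable fun z => ‖u z‖ₑ ^ p.toReal := (hu.measurable.enorm).pow_const _
  have hterm : ∀ j : ℕ, ∫⁻ z, ‖u z‖ₑ ^ p.toReal * (ball x (2 ^ j)).indicator
        (fun _ => ENNReal.ofReal (2 ^ (n + 1) * ((2 ^ j) ^ (n + 1))⁻¹)) z ≤
        (ENNReal.ofReal (2 ^ (n + 1)) * ω * ENNReal.ofReal ((1 + dist x y) ^ n) * M) *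
          (2⁻¹ : ℝ≥0∞) ^ j := by
    intro j
    have e1 : ∫⁻ z, ‖u z‖ₑ ^ p.toReal * (ball x (2 ^ j)).indicator
        (fun _ => ENNReal.ofReal (2 ^ (n + 1) * ((2 ^ j) ^ (n + 1))⁻¹)) z
        = (∫⁻ z in ball x (2 ^ j), ‖u z‖ₑ ^ p.toReal) *
          ENNReal.ofReal (2 ^ (n + 1) * ((2 ^ j) ^ (n + 1))⁻¹) := by
      rw [← lintegral_mul_const _ hm, ← lintegral_indicator measurableSet_ball]
      congr 1; ext z
      by_cases hz : z ∈ ball x (2 ^ j) <;> simp [hz]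
    have hR : 0 < (2 ^ j * (1 + dist x y) : ℝ) := by positivity
    have h2 : (1 : ℝ) ≤ 2 ^ j := one_le_pow₀ one_le_two
    have hd := dist_nonneg (x := x) (y := y)
    have hy : y ∈ ball x (2 ^ j * (1 + dist x y)) := by
      rw [mem_ball, dist_comm]; nlinarith
    have hsub : ball x (2 ^ j) ⊆ ball x (2 ^ j * (1 + dist x y)) :=
      ball_subset_ball (by nlinarith)
    rw [e1]
    calc _ ≤ (M * volume (ball x (2 ^ j * (1 + dist x y)))) *
          ENNReal.ofReal (2 ^ (n + 1) * ((2 ^ j) ^ (n + 1))⁻¹) := by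
          gcongr
          exact (lintegral_mono_set hsub).trans (ball_le_max p hp hp' u x y _ hR hy)
      _ = (ENNReal.ofReal ((2 ^ j * (1 + dist x y)) ^ n) *
          ENNReal.ofReal (2 ^ (n + 1) * ((2 ^ j) ^ (n + 1))⁻¹)) * (ω * M) := by
          rw [Measure.addHaar_ball_of_pos _ _ hR]
          simp only [finrank_euclideanSpace, Fintype.card_fin]
          ring
      _ = (ENNReal.ofReal (2 ^ (n + 1)) * ENNReal.ofReal ((1 + dist x y) ^ n) *
            ENNReal.ofReal (2⁻¹ ^ j)) * (ω * M) := by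
          rw [← ENNReal.ofReal_mul (by positivity), ← ENNReal.ofReal_mul (by positivity),
            ← ENNReal.ofReal_mul (by positivity)]
          congr 2
          rw [mul_pow, pow_succ (2 ^ j : ℝ) n, inv_pow]
          field_simp
      _ = _ := by
          rw [ENNReal.ofReal_pow (by positivity : (0 : ℝ) ≤ 2⁻¹), ENNReal.ofReal_inv_of_pos two_pos]
          simp only [ENNReal.ofReal_ofNat]
          ring
  calc _ ≤ ∫⁻ z, ∑' j : ℕ, ‖u z‖ₑ ^ p.toReal * (ball x (2 ^ j)).indicator
        (fun _ => ENNReal.ofReal (2 ^ (n + 1) * ((2 ^ j) ^ (n + 1))⁻¹)) z := by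
        refine lintegral_mono fun z => ?_
        rw [ENNReal.tsum_mul_left]
        gcongr
        exact ker_le_dyadic x z
    _ = ∑' j : ℕ, ∫⁻ z, ‖u z‖ₑ ^ p.toReal * (ball x (2 ^ j)).indicator
        (fun _ => ENNReal.ofReal (2 ^ (n + 1) * ((2 ^ j) ^ (n + 1))⁻¹)) z := by
        refine lintegral_tsum fun j => ?_
        exact (hm.mul (measurable_const.indicator measurableSet_ball)).aemeasurable
    _ ≤ ∑' j : ℕ, (ENNReal.ofReal (2 ^ (n + 1)) * ω * ENNReal.ofReal ((1 + dist x y) ^ n) * M) *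
          (2⁻¹ : ℝ≥0∞) ^ j := ENNReal.tsum_le_tsum hterm
    _ = _ := by
        rw [ENNReal.tsum_mul_left, ENNReal.tsum_geometric, ENNReal.one_sub_inv_two, inv_inv]
        ring

/-- Stromberg-Torchinsky type lemma, `q ≤ 1` -/
theorem small_exp {n : ℕ} (φ : SchwartzMap (EuclideanSpace ℝ (Fin n)) ℂ) (q : ℝ)
    (hq : 0 < q) (hq1 : q ≤ 1) (N : ℕ) (hN : (n + 1 : ℝ) ≤ N * q) :
    ∃ C : ℝ≥0∞, C < ∞ ∧
      ∀ u : EuclideanSpace ℝ (Fin n) → ℂ, (∀ x, u x = ∫ y, u y * φ (x - y)) →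
      ∀ x A, (∀ z, ‖u z‖ ≤ A * (1 + dist x z) ^ N) →
        ‖u x‖ₑ ^ q ≤ C * ∫⁻ z, ‖u z‖ₑ ^ q * ENNReal.ofReal (((1 + dist x z) ^ (n + 1))⁻¹) := by
  obtain ⟨C, hC, hφ⟩ := schwartz_decay φ N
  refine ⟨ENNReal.ofReal C, ENNReal.ofReal_lt_top, fun u hu x A hA => ?_⟩
  set I := ∫⁻ z, ‖u z‖ₑ ^ q * ENNReal.ofReal (((1 + dist x z) ^ (n + 1))⁻¹) with hI
  set g : EuclideanSpace ℝ (Fin n) → ℝ := fun z => ‖u z‖ * ((1 + dist x z) ^ N)⁻¹ with hg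
  have hbdd : BddAbove (Set.range g) := by
    refine ⟨A, ?_⟩
    rintro _ ⟨z, rfl⟩
    simp only [hg]
    rw [← div_eq_mul_inv, div_le_iff₀ (by positivity)]
    exact hA z
  set V := ⨆ z, g z with hV
  have hgV : ∀ z, g z ≤ V := fun z => le_ciSup hbdd z
  have hV0 : 0 ≤ V := le_trans (by simp only [hg]; positivity) (hgV x)
  have huV : ∀ z, ‖u z‖ ≤ V * (1 + dist x z) ^ N := fun z => by
    have := hgV z
    simp only [hg] at this
    rwa [← div_eq_mul_inv, div_le_iff₀ (by positivity)] at this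
  have hxV : ‖u x‖ ≤ V := by simpa using huV x
  rcases hV0.eq_or_lt with h0 | hVpos
  · have : ‖u x‖ₑ = 0 := by
      rw [← h0] at hxV
      simpa using hxV
    rw [this, ENNReal.zero_rpow_of_pos hq]; exact zero_le
  by_cases hItop : ENNReal.ofReal C * I = ∞
  · rw [hItop]; exact le_top
  -- key pointwise inequality
  have key : ∀ x' z, ‖u z‖ * ‖φ (x' - z)‖ * ((1 + dist x x') ^ N)⁻¹ ≤
      (C * V ^ (1 - q)) * (‖u z‖ ^ q * ((1 + dist x z) ^ (n + 1))⁻¹) := by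
    intro x' z
    set T := 1 + dist x z
    set S := 1 + ‖x' - z‖
    set Q := 1 + dist x x'
    have hT1 : 1 ≤ T := by simp [T]
    have hT : 0 < T := by positivity
    have hS : 0 < S := by positivity
    have hQ : 0 < Q := by positivity
    have hTSQ : T ≤ S * Q := by
      have := dist_triangle x x' z
      simp only [T, S, Q, ← dist_eq_norm]
      nlinarith [dist_nonneg (x := x) (y := x'), dist_nonneg (x := x') (y := z),
        mul_nonneg (dist_nonneg (x := x) (y := x')) (dist_nonneg (x := x') (y := z))]
    have e1 : ‖u z‖ = ‖u z‖ ^ q * ‖u z‖ ^ (1 - q) := by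
      rw [← Real.rpow_add_of_nonneg (norm_nonneg _) hq.le (by linarith)]
      simp
    have e2 : ‖u z‖ ^ (1 - q) ≤ V ^ (1 - q) * (T ^ N) ^ (1 - q) := by
      rw [← Real.mul_rpow hV0 (by positivity)]
      exact Real.rpow_le_rpow (norm_nonneg _) (huV z) (by linarith)
    have e3 : (T ^ N) ^ (1 - q) * ((S * Q) ^ N)⁻¹ ≤ (T ^ (n + 1))⁻¹ := by
      calc (T ^ N) ^ (1 - q) * ((S * Q) ^ N)⁻¹ ≤ (T ^ N) ^ (1 - q) * (T ^ N)⁻¹ := by gcongr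
        _ = T ^ (-(N * q)) := by
          rw [← Real.rpow_natCast T N, ← Real.rpow_mul hT.le, ← Real.rpow_neg hT.le,
            ← Real.rpow_add hT]
          congr 1; ring
        _ ≤ T ^ (-((n + 1 : ℕ) : ℝ)) := by
          apply Real.rpow_le_rpow_of_exponent_le hT1
          push_cast; linarith
        _ = _ := by rw [Real.rpow_neg hT.le, Real.rpow_natCast]
    calc ‖u z‖ * ‖φ (x' - z)‖ * (Q ^ N)⁻¹
        ≤ (‖u z‖ ^ q * (V ^ (1 - q) * (T ^ N) ^ (1 - q))) * (C * (S ^ N)⁻¹) * (Q ^ N)⁻¹ := by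
          gcongr
          · nth_rw 1 [e1]
            gcongr
          · exact hφ _
      _ = (C * V ^ (1 - q)) * (‖u z‖ ^ q * ((T ^ N) ^ (1 - q) * ((S * Q) ^ N)⁻¹)) := by
          rw [mul_pow, mul_inv]; ring
      _ ≤ _ := by gcongr
  have key2 : ∀ x', ENNReal.ofReal (g x') ≤ ENNReal.ofReal (V ^ (1 - q)) * (ENNReal.ofReal C * I) := by
    intro x'
    calc ENNReal.ofReal (g x') = ‖u x'‖ₑ * ENNReal.ofReal (((1 + dist x x') ^ N)⁻¹) := by
          simp only [hg]
          rw [ENNReal.ofReal_mul (norm_nonneg _), ofReal_norm]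
      _ ≤ (∫⁻ z, ‖u z * φ (x' - z)‖ₑ) * ENNReal.ofReal (((1 + dist x x') ^ N)⁻¹) := by
          gcongr
          nth_rw 1 [hu x']
          exact enorm_integral_le_lintegral_enorm _
      _ = ∫⁻ z, ‖u z * φ (x' - z)‖ₑ * ENNReal.ofReal (((1 + dist x x') ^ N)⁻¹) := by
          rw [lintegral_mul_const' _ _ ENNReal.ofReal_ne_top]
      _ ≤ ∫⁻ z, (ENNReal.ofReal C * ENNReal.ofReal (V ^ (1 - q))) *
            (‖u z‖ₑ ^ q * ENNReal.ofReal (((1 + dist x z) ^ (n + 1))⁻¹)) := by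
          refine lintegral_mono fun z => ?_
          have := ENNReal.ofReal_le_ofReal (key x' z)
          rw [ENNReal.ofReal_mul (by positivity), ENNReal.ofReal_mul (by positivity),
            ENNReal.ofReal_mul (by positivity), ENNReal.ofReal_mul hC.le, ENNReal.ofReal_mul (by positivity),
            ← ENNReal.ofReal_rpow_of_nonneg (norm_nonneg _) hq.le, ofReal_norm,
            ofReal_norm] at this
          rwa [enorm_mul]
      _ = _ := by
          rw [lintegral_const_mul' _ _ (ENNReal.mul_ne_top ENNReal.ofReal_ne_top ENNReal.ofReal_ne_top)]
          ring
  set J := (ENNReal.ofReal C * I).toReal with hJ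
  have hJ' : ENNReal.ofReal C * I = ENNReal.ofReal J := (ENNReal.ofReal_toReal hItop).symm
  have hJ0 : 0 ≤ J := ENNReal.toReal_nonneg
  have hVJ : V ≤ V ^ (1 - q) * J := by
    refine ciSup_le fun x' => ?_
    have := key2 x'
    rw [hJ', ← ENNReal.ofReal_mul (by positivity)] at this
    exact (ENNReal.ofReal_le_ofReal_iff (by positivity)).1 this
  have hVq : V ^ q ≤ J := by
    have : V ^ (1 - q) * V ^ q = V := by rw [← Real.rpow_add hVpos]; simp
    have hpos : 0 < V ^ (1 - q) := by positivity
    exact le_of_mul_le_mul_left (by rw [this]; exact hVJ) hpos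
  rw [hJ', ← ofReal_norm, ENNReal.ofReal_rpow_of_nonneg (norm_nonneg _) hq.le]
  exact ENNReal.ofReal_le_ofReal ((Real.rpow_le_rpow (norm_nonneg _) hxV hq.le).trans hVq)

/-- the case `q > 1`: Hölder -/
theorem large_exp {n : ℕ} (φ : SchwartzMap (EuclideanSpace ℝ (Fin n)) ℂ) (q : ℝ) (hq : 1 < q) :
    ∃ C : ℝ≥0∞, C < ∞ ∧
      ∀ u : EuclideanSpace ℝ (Fin n) → ℂ, Continuous u → (∀ x, u x = ∫ y, u y * φ (x - y)) →
      ∀ x,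
        ‖u x‖ₑ ^ q ≤ C * ∫⁻ z, ‖u z‖ₑ ^ q * ENNReal.ofReal (((1 + dist x z) ^ (n + 1))⁻¹) := by
  obtain ⟨C, hC, hφ⟩ := schwartz_decay φ (n + 1)
  set K := ∫⁻ z : EuclideanSpace ℝ (Fin n), ENNReal.ofReal (((1 + dist 0 z) ^ (n + 1))⁻¹) with hK
  have hKfin : K < ∞ := (integrable_ker (0 : EuclideanSpace ℝ (Fin n))).lintegral_lt_top
  have hKx : ∀ x : EuclideanSpace ℝ (Fin n),
      ∫⁻ z, ENNReal.ofReal (((1 + dist x z) ^ (n + 1))⁻¹) = K := by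
    intro x
    rw [hK, ← lintegral_sub_left_eq_self _ x]
    congr 1; ext z
    simp [dist_eq_norm]
  set r := Real.conjExponent q
  have hqr : q.HolderConjugate r := Real.HolderConjugate.conjExponent hq
  have hq0 : 0 < q := by linarith
  refine ⟨(ENNReal.ofReal C * K ^ (1 / r)) ^ q, ?_, fun u huc hu x => ?_⟩
  · refine ENNReal.rpow_lt_top_of_nonneg hq0.le (ENNReal.mul_ne_top ENNReal.ofReal_ne_top ?_)
    exact (ENNReal.rpow_lt_top_of_nonneg (by have := hqr.symm.pos; positivity) hKfin.ne).ne
  set w : EuclideanSpace ℝ (Fin n) → ℝ≥0∞ :=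
    fun z => ENNReal.ofReal (((1 + dist x z) ^ (n + 1))⁻¹) with hw
  have hwm : Measurable w := by simp only [hw]; fun_prop
  have hum : Measurable fun z => ‖u z‖ₑ := huc.measurable.enorm
  have hr0 : 0 < r := hqr.symm.pos
  have h1 : ‖u x‖ₑ ≤ ENNReal.ofReal C * ∫⁻ z, ‖u z‖ₑ * w z := by
    rw [← lintegral_const_mul' _ _ ENNReal.ofReal_ne_top]
    nth_rw 1 [hu x]
    refine (enorm_integral_le_lintegral_enorm _).trans (lintegral_mono fun z => ?_)
    rw [enorm_mul]
    have := ENNReal.ofReal_le_ofReal (hφ (x - z))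
    rw [ENNReal.ofReal_mul hC.le, ofReal_norm, ← dist_eq_norm] at this
    calc ‖u z‖ₑ * ‖φ (x - z)‖ₑ ≤ ‖u z‖ₑ * (ENNReal.ofReal C * w z) := by gcongr
      _ = _ := by ring
  have h2 : ∫⁻ z, ‖u z‖ₑ * w z ≤ (∫⁻ z, ‖u z‖ₑ ^ q * w z) ^ (1 / q) * K ^ (1 / r) := by
    have := ENNReal.lintegral_mul_le_Lp_mul_Lq volume hqr
      (f := fun z => ‖u z‖ₑ * w z ^ (1 / q)) (g := fun z => w z ^ (1 / r))
      (hum.mul (hwm.pow_const _)).aemeasurable (hwm.pow_const _).aemeasurable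
    refine le_trans (le_of_eq ?_) (this.trans (le_of_eq ?_))
    · congr 1; ext z
      simp only [Pi.mul_apply]
      rw [mul_assoc, ← ENNReal.rpow_add_of_nonneg _ _ (by positivity) (by positivity)]
      have : 1 / q + 1 / r = 1 := by simpa [one_div] using hqr.inv_add_inv_eq_one
      rw [this, ENNReal.rpow_one]
    · rw [← hKx x]
      congr 2
      · congr 1; ext z
        rw [ENNReal.mul_rpow_of_nonneg _ _ hq0.le, ← ENNReal.rpow_mul, one_div_mul_cancel hq0.ne',
          ENNReal.rpow_one]
      · congr 1; ext z
        rw [← ENNReal.rpow_mul, one_div_mul_cancel hr0.ne', ENNReal.rpow_one]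
  calc ‖u x‖ₑ ^ q ≤ (ENNReal.ofReal C * ((∫⁻ z, ‖u z‖ₑ ^ q * w z) ^ (1 / q) * K ^ (1 / r))) ^ q := by
        gcongr
        exact h1.trans (by gcongr)
    _ = ((ENNReal.ofReal C * K ^ (1 / r)) * (∫⁻ z, ‖u z‖ₑ ^ q * w z) ^ (1 / q)) ^ q := by
        congr 1; ring
    _ = _ := by
        rw [ENNReal.mul_rpow_of_nonneg _ _ hq0.le, ← ENNReal.rpow_mul _ (1 / q) q,
          one_div_mul_cancel hq0.ne', ENNReal.rpow_one]

/-- extracting `q`-th roots -/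
theorem root_step {n : ℕ} (q : ℝ) (hq : 0 < q) (a D M : ℝ≥0∞) (R : ℝ) (hR : 0 < R)
    (h : a ^ q ≤ D * ENNReal.ofReal (R ^ n) * M ^ q) :
    a ≤ (D ^ (1 / q) + 1) * ENNReal.ofReal (R ^ ((n : ℝ) / q)) * M := by
  have h1 : a ≤ (D * ENNReal.ofReal (R ^ n) * M ^ q) ^ (1 / q) := by
    rwa [one_div, ENNReal.le_rpow_inv_iff hq]
  refine h1.trans ?_
  have hq' : 0 ≤ 1 / q := by positivity
  rw [ENNReal.mul_rpow_of_nonneg _ _ hq', ENNReal.mul_rpow_of_nonneg _ _ hq', ← ENNReal.rpow_mul,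
    mul_one_div_cancel hq.ne', ENNReal.rpow_one,
    ENNReal.ofReal_rpow_of_nonneg (by positivity) hq', ← Real.rpow_natCast, ← Real.rpow_mul hR.le,
    mul_one_div]
  gcongr
  exact le_self_add

theorem one_add_dist_le {n : ℕ} (x y z : EuclideanSpace ℝ (Fin n)) :
    1 + dist x z ≤ (1 + dist x y) * (1 + dist y z) := by
  have := dist_triangle x y z
  nlinarith [mul_nonneg (dist_nonneg (x := x) (y := y)) (dist_nonneg (x := y) (y := z))]

/-- Peetre-type maximal inequality.  Let `φ` be a Schwartz function and `u` a tempered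
distribution with `u = u * φ` (identified with a continuous function of polynomial growth
satisfying the pointwise reproducing identity `u x = ∫ u y · φ(x−y) dy`).  Then `u` is smooth
and, for every `p ∈ (0,∞]`, there is `C > 0` (depending only on `φ, p, n`) with
`|u x| ≤ C (1 + |x−y|)^{n/p} (M_p u)(y)` for all `x, y`. -/
theorem stmt_6 {n : ℕ} (φ : SchwartzMap (EuclideanSpace ℝ (Fin n)) ℂ) (p : ℝ≥0∞)
    (hp : 0 < p) :
    ∃ C : ℝ≥0∞, 0 < C ∧ C < ∞ ∧
      ∀ u : EuclideanSpace ℝ (Fin n) → ℂ, Continuous u →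
        (∃ (A : ℝ) (k : ℕ), ∀ x, ‖u x‖ ≤ A * (1 + ‖x‖) ^ k) →
        (∀ x, u x = ∫ y, u y * φ (x - y)) →
        ContDiff ℝ (⊤ : ℕ∞) u ∧
          ∀ x y, (‖u x‖₊ : ℝ≥0∞) ≤
            C * ENNReal.ofReal ((1 + dist x y) ^ ((n : ℝ) / p.toReal)) * maximalFn p u y := by
  suffices H : ∃ C : ℝ≥0∞, 0 < C ∧ C < ∞ ∧
      ∀ u : EuclideanSpace ℝ (Fin n) → ℂ, Continuous u →
        (∃ (A : ℝ) (k : ℕ), ∀ x, ‖u x‖ ≤ A * (1 + ‖x‖) ^ k) →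
        (∀ x, u x = ∫ y, u y * φ (x - y)) →
          ∀ x y, ‖u x‖ₑ ≤
            C * ENNReal.ofReal ((1 + dist x y) ^ ((n : ℝ) / p.toReal)) * maximalFn p u y by
    obtain ⟨C, h0, h1, h⟩ := H
    refine ⟨C, h0, h1, fun u huc hg hu => ⟨?_, h u huc hg hu⟩⟩
    obtain ⟨A, k, hA⟩ := hg
    have hc := fun m : ℕ => conv_contDiff u huc A k hA m φ
    have e : (fun x => ∫ y, u y • φ (x - y)) = u := by
      ext x; simp only [smul_eq_mul]; exact (hu x).symm
    rw [e] at hc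
    exact contDiff_infty.2 hc
  by_cases hp' : p = ∞
  · refine ⟨1, one_pos, ENNReal.one_lt_top, fun u huc _ _ x y => ?_⟩
    subst hp'
    simp only [ENNReal.toReal_top, _root_.div_zero, Real.rpow_zero, ENNReal.ofReal_one, one_mul, maximalFn,
      if_true]
    rw [eLpNorm_exponent_top]
    have hae : ∀ᵐ z, ‖u z‖ₑ ≤ eLpNormEssSup u volume := enorm_ae_le_eLpNormEssSup u volume
    have hcl : IsClosed {z | ‖u z‖ₑ ≤ eLpNormEssSup u volume} :=
      isClosed_le huc.enorm continuous_const
    have hd : Dense {z | ‖u z‖ₑ ≤ eLpNormEssSup u volume} := Measure.dense_of_ae hae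
    have := hcl.closure_eq ▸ hd x
    exact this
  set q := p.toReal with hqdef
  have hq : 0 < q := ENNReal.toReal_pos hp.ne' hp'
  set B := ENNReal.ofReal (2 ^ (n + 1)) * volume (ball (0 : EuclideanSpace ℝ (Fin n)) 1) * 2 with hB
  have hBfin : B < ∞ := by
    refine ENNReal.mul_lt_top (ENNReal.mul_lt_top ENNReal.ofReal_lt_top measure_ball_lt_top) ?_
    simp
  have fin : ∀ C : ℝ≥0∞, C < ∞ → ((C * B) ^ (1 / q) + 1) < ∞ := fun C hC => by
    refine ENNReal.add_lt_top.2 ⟨?_, ENNReal.one_lt_top⟩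
    exact ENNReal.rpow_lt_top_of_nonneg (by positivity) (ENNReal.mul_lt_top hC hBfin).ne
  have finish : ∀ (C : ℝ≥0∞) (u : EuclideanSpace ℝ (Fin n) → ℂ), Continuous u → ∀ x y,
      ‖u x‖ₑ ^ q ≤ C * ∫⁻ z, ‖u z‖ₑ ^ q * ENNReal.ofReal (((1 + dist x z) ^ (n + 1))⁻¹) →
      ‖u x‖ₑ ≤ ((C * B) ^ (1 / q) + 1) * ENNReal.ofReal ((1 + dist x y) ^ ((n : ℝ) / q)) *
        maximalFn p u y := by
    intro C u huc x y h
    refine root_step q hq _ _ _ _ (by positivity) (h.trans ?_)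
    calc _ ≤ C * (B * ENNReal.ofReal ((1 + dist x y) ^ n) * maximalFn p u y ^ q) := by
          gcongr
          exact int_le_max p hp hp' u huc x y
      _ = _ := by ring
  rcases lt_or_ge 1 q with hq1 | hq1
  · obtain ⟨C, hC, h⟩ := large_exp φ q hq1
    refine ⟨(C * B) ^ (1 / q) + 1, by positivity, fin C hC, fun u huc _ hu x y => ?_⟩
    exact finish C u huc x y (h u huc hu x)
  · obtain ⟨N, hN⟩ := exists_nat_ge ((n + 1 : ℝ) / q)
    have hNq : (n + 1 : ℝ) ≤ N * q := by rwa [div_le_iff₀ hq] at hN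
    obtain ⟨C, hC, h⟩ := small_exp φ q hq hq1 N hNq
    refine ⟨(C * B) ^ (1 / q) + 1, by positivity, fin C hC, fun u huc hg hu x y => ?_⟩
    by_cases hM : maximalFn p u y = ∞
    · rw [hM, ENNReal.mul_top]
      · exact le_top
      · refine mul_ne_zero (by positivity) ?_
        rw [← pos_iff_ne_zero, ENNReal.ofReal_pos]
        positivity
    obtain ⟨A, k, hA⟩ := hg
    have hA0 : 0 ≤ A := by
      have := (norm_nonneg _).trans (hA 0)
      simpa using this
    -- first pass, with constants depending on the growth of `u`
    have hNq1 : (n + 1 : ℝ) ≤ (max k N : ℕ) * q := by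
      refine hNq.trans ?_
      gcongr
      exact le_max_right _ _
    obtain ⟨C₁, hC₁, h₁⟩ := small_exp φ q hq hq1 (max k N) hNq1
    have first : ∀ x', ‖u x'‖ₑ ≤ ((C₁ * B) ^ (1 / q) + 1) *
        ENNReal.ofReal ((1 + dist x' y) ^ ((n : ℝ) / q)) * maximalFn p u y := by
      intro x'
      refine finish C₁ u huc x' y (h₁ u hu x' (A * (1 + dist 0 x') ^ (max k N)) fun z => ?_)
      calc ‖u z‖ ≤ A * (1 + dist 0 z) ^ k := by simpa [dist_eq_norm] using hA z
        _ ≤ A * (1 + dist 0 z) ^ (max k N) := by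
          gcongr
          · simp
          · exact le_max_left _ _
        _ ≤ A * ((1 + dist 0 x') * (1 + dist x' z)) ^ (max k N) := by
          gcongr
          exact one_add_dist_le 0 x' z
        _ = _ := by rw [mul_pow]; ring
    set G := ((C₁ * B) ^ (1 / q) + 1) * maximalFn p u y with hG
    have hGfin : G ≠ ∞ := ENNReal.mul_ne_top (fin C₁ hC₁).ne hM
    refine finish C u huc x y (h u hu x (G.toReal * (1 + dist x y) ^ N) fun z => ?_)
    have hz : ‖u z‖ ≤ G.toReal * (1 + dist z y) ^ ((n : ℝ) / q) := by
      have h2 : ‖u z‖ₑ ≤ ENNReal.ofReal (G.toReal * (1 + dist z y) ^ ((n : ℝ) / q)) := by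
        rw [ENNReal.ofReal_mul ENNReal.toReal_nonneg, ENNReal.ofReal_toReal hGfin]
        refine (first z).trans (le_of_eq ?_)
        rw [hG]; ring
      rw [← ofReal_norm] at h2
      exact (ENNReal.ofReal_le_ofReal_iff (by positivity)).1 h2
    calc ‖u z‖ ≤ G.toReal * (1 + dist z y) ^ ((n : ℝ) / q) := hz
      _ ≤ G.toReal * (1 + dist z y) ^ (N : ℝ) := by
        gcongr
        · simp
        · refine le_trans ?_ hN
          gcongr
          linarith
      _ = G.toReal * (1 + dist z y) ^ N := by rw [Real.rpow_natCast]
      _ ≤ G.toReal * ((1 + dist z x) * (1 + dist x y)) ^ N := by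
        gcongr
        exact one_add_dist_le z x y
      _ = _ := by rw [mul_pow, dist_comm z x]; ring
end

section
/- Let φ₁, φ₂ ∈ 𝒮(ℝ^n), α₁, α₂ > 0, and p₁, p₂, p₃ ∈ (0,∞] with p₁ ≤ p₃, p₂ ≤ p₃ and 1/p₁' + 1/p₂' ≤ 1/p₃' (where r' = max(1,r)'). Then there is C > 0 such that ‖ |u₁|^{α₁} * |u₂(−·)|^{α₂} ‖_{L^{p₃}} ≤ C ‖ |u₁|^{α₁} ‖_{L^{p₁}} ‖ |u₂|^{α₂} ‖_{L^{p₂}} for every u₁ ∈ 𝒪(φ₁) and u₂ ∈ 𝒪(φ₂) for which the right-hand side is finite. -/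
open MeasureTheory ENNReal

namespace YoungBL

abbrev EE (n : ℕ) := EuclideanSpace ℝ (Fin n)

/-- The weight `(1 + |x|)⁻¹`. -/
noncomputable def W {n : ℕ} (x : EE n) : ℝ≥0∞ := (ENNReal.ofReal (1 + ‖x‖))⁻¹

lemma W_cont {n : ℕ} : Continuous (W : EE n → ℝ≥0∞) := by
  unfold W
  exact (ENNReal.continuous_ofReal.comp (by fun_prop)).inv

lemma W_meas {n : ℕ} : Measurable (W : EE n → ℝ≥0∞) := W_cont.measurable

lemma W_neg {n : ℕ} (x : EE n) : W (-x) = W x := by simp [W]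

lemma W_comm {n : ℕ} (x y : EE n) : W (x - y) = W (y - x) := by
  rw [← W_neg, neg_sub]

lemma W_le_one {n : ℕ} (x : EE n) : W x ≤ 1 := by
  unfold W
  rw [ENNReal.inv_le_one, ← ENNReal.ofReal_one]
  exact ENNReal.ofReal_le_ofReal (by linarith [norm_nonneg x])

lemma W_ne_top {n : ℕ} (x : EE n) : W x ≠ ∞ := ne_top_of_le_ne_top one_ne_top (W_le_one x)

lemma W_ne_zero {n : ℕ} (x : EE n) : W x ≠ 0 := by
  simp [W]

lemma W_sub {n : ℕ} (x y z : EE n) : W (x - y) * W (y - z) ≤ W (x - z) := by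
  unfold W
  rw [← ENNReal.mul_inv (by right; simp) (by left; simp), ENNReal.inv_le_inv,
    ← ENNReal.ofReal_mul (by positivity)]
  apply ENNReal.ofReal_le_ofReal
  have := norm_sub_le_norm_sub_add_norm_sub x y z
  nlinarith [norm_nonneg (x - y), norm_nonneg (y - z),
    mul_nonneg (norm_nonneg (x - y)) (norm_nonneg (y - z))]

lemma W_sub_pow {n : ℕ} (N : ℕ) (x y z : EE n) :
    W (x - y) ^ N * W (y - z) ^ N ≤ W (x - z) ^ N := by
  rw [← mul_pow]
  exact pow_le_pow_left' (W_sub x y z) N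

lemma W_pow_anti {n : ℕ} {N M : ℕ} (h : N ≤ M) (x : EE n) : W x ^ M ≤ W x ^ N :=
  pow_le_pow_right_of_le_one' (W_le_one x) h

lemma W_int {n : ℕ} {M : ℕ} (hM : n < M) : ∫⁻ x : EE n, W x ^ M ≠ ∞ := by
  have h := finite_integral_one_add_norm (E := EE n) (μ := volume) (r := (M : ℝ))
    (by simpa using hM)
  refine ne_top_of_le_ne_top h.ne (lintegral_mono fun x => ?_)
  rw [Real.rpow_neg (by positivity), ENNReal.ofReal_inv_of_pos (by positivity), Real.rpow_natCast,
    ENNReal.ofReal_pow (by positivity), W, ENNReal.inv_pow]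

lemma W_int_pos {n : ℕ} {M : ℕ} : ∫⁻ x : EE n, W x ^ M ≠ 0 := by
  intro h
  rw [lintegral_eq_zero_iff (W_meas.pow_const _)] at h
  have : ∀ᵐ x : EE n, False := by
    filter_upwards [h] with x hx
    exact pow_ne_zero M (W_ne_zero x) hx
  rw [Filter.eventually_false_iff_eq_bot, ae_eq_bot] at this
  exact NeZero.ne _ this

lemma schwartz_bound {n : ℕ} (φ : SchwartzMap (EE n) ℂ) (N : ℕ) :
    ∃ C : ℝ≥0∞, C ≠ ∞ ∧ ∀ x, ‖φ x‖ₑ ≤ C * W x ^ N := by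
  refine ⟨ENNReal.ofReal (2 ^ N * (Finset.Iic (N, 0)).sup
    (fun m => SchwartzMap.seminorm ℝ m.1 m.2) φ), ENNReal.ofReal_ne_top, fun x => ?_⟩
  have h := SchwartzMap.one_add_le_sup_seminorm_apply (𝕜 := ℝ) (m := (N, 0)) le_rfl le_rfl φ x
  simp only [norm_iteratedFDeriv_zero] at h
  rw [W, ← ENNReal.inv_pow, ← div_eq_mul_inv, ENNReal.le_div_iff_mul_le
    (by left; exact pow_ne_zero _ (by simp; positivity)) (by left; simp), ← ofReal_norm, ← ENNReal.ofReal_pow (by positivity),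
    ← ENNReal.ofReal_mul (by positivity), mul_comm]
  exact ENNReal.ofReal_le_ofReal h

/-- The class of (nonnegative parts of) functions in `𝒪(φ)`. -/
def Rep {n : ℕ} (φ : SchwartzMap (EE n) ℂ) (U : EE n → ℝ≥0∞) : Prop :=
  Continuous U ∧ (∀ x, U x ≤ ∫⁻ y, U y * ‖φ (x - y)‖ₑ) ∧
    ∃ (A : ℝ≥0∞) (k : ℕ), A ≠ ∞ ∧ ∀ x, U x * W x ^ k ≤ A

lemma rep_of {n : ℕ} (φ : SchwartzMap (EE n) ℂ) (u : EE n → ℂ) (hu : Continuous u)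
    (hg : ∃ (A : ℝ) (k : ℕ), ∀ x, ‖u x‖ ≤ A * (1 + ‖x‖) ^ k)
    (hr : ∀ x, u x = ∫ y, u y * φ (x - y)) : Rep φ (fun x => ‖u x‖ₑ) := by
  refine ⟨by fun_prop, fun x => ?_, ?_⟩
  · calc ‖u x‖ₑ = ‖∫ y, u y * φ (x - y)‖ₑ := by rw [← hr x]
      _ ≤ ∫⁻ y, ‖u y * φ (x - y)‖ₑ := enorm_integral_le_lintegral_enorm _
      _ = _ := by simp [enorm_mul]
  · obtain ⟨A, k, h⟩ := hg
    refine ⟨ENNReal.ofReal A, k, ENNReal.ofReal_ne_top, fun x => ?_⟩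
    simp only [W]
    rw [← ENNReal.inv_pow, ← div_eq_mul_inv]
    apply ENNReal.div_le_of_le_mul
    rw [← ofReal_norm, ← ENNReal.ofReal_pow (by positivity),
      ← ENNReal.ofReal_mul' (by positivity)]
    exact ENNReal.ofReal_le_ofReal (h x)

/-- Step one: bootstrap when the maximal function is finite. -/
lemma step_one {n : ℕ} (φ : SchwartzMap (EE n) ℂ) {s : ℝ} (hs : 0 < s) (hs1 : s < 1) (N : ℕ) :
    ∃ C : ℝ≥0∞, C ≠ ∞ ∧ ∀ U, Rep φ U → ∀ x, (⨆ y, U y * W (x - y) ^ N) ≠ ∞ →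
      (U x) ^ s ≤ C * ∫⁻ z, U z ^ s * (W (x - z) ^ N) ^ s := by
  obtain ⟨C, hC, hφ⟩ := schwartz_bound φ N
  refine ⟨C, hC, fun U hU x hA => ?_⟩
  set A := ⨆ y, U y * W (x - y) ^ N with hAdef
  set J := ∫⁻ z, U z ^ s * (W (x - z) ^ N) ^ s with hJ
  have hUA : ∀ z, U z * W (x - z) ^ N ≤ A := fun z => le_iSup (fun y => U y * W (x - y) ^ N) z
  have hUx : U x ≤ A := by
    have := hUA x
    simpa [W] using this
  have hWm : Measurable fun z => W (x - z) := W_meas.comp (by fun_prop)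
  have hUm : Measurable U := hU.1.measurable
  have key : A ≤ C * (A ^ (1 - s) * J) := by
    refine iSup_le fun y => ?_
    calc U y * W (x - y) ^ N ≤ (∫⁻ z, U z * ‖φ (y - z)‖ₑ) * W (x - y) ^ N := by
          gcongr; exact hU.2.1 y
      _ = ∫⁻ z, U z * ‖φ (y - z)‖ₑ * W (x - y) ^ N := by
          rw [lintegral_mul_const']
          exact ENNReal.pow_ne_top (W_ne_top _)
      _ ≤ ∫⁻ z, C * (A ^ (1 - s) * (U z ^ s * (W (x - z) ^ N) ^ s)) := by
          refine lintegral_mono fun z => ?_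
          calc U z * ‖φ (y - z)‖ₑ * W (x - y) ^ N
              ≤ U z * (C * W (y - z) ^ N) * W (x - y) ^ N := by gcongr; exact hφ _
            _ = C * (U z * (W (x - y) ^ N * W (y - z) ^ N)) := by ring
            _ ≤ C * (U z * W (x - z) ^ N) := by gcongr; exact W_sub_pow N x y z
            _ = C * ((U z * W (x - z) ^ N) ^ (1 - s) * (U z * W (x - z) ^ N) ^ s) := by
                rw [← ENNReal.rpow_add_of_nonneg _ _ (by linarith) hs.le]
                simp
            _ ≤ C * (A ^ (1 - s) * (U z * W (x - z) ^ N) ^ s) := by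
                gcongr
                exact hUA z
            _ = _ := by rw [ENNReal.mul_rpow_of_nonneg _ _ hs.le]
      _ = _ := by
          rw [lintegral_const_mul _ (by fun_prop), lintegral_const_mul _ (by fun_prop)]
  have hAs : A ^ s ≤ C * J := by
    rcases eq_or_ne A 0 with h0 | h0
    · rw [h0, ENNReal.zero_rpow_of_pos hs]; exact zero_le
    have h1 : A ^ (1 - s) ≠ 0 := by
      simp only [ne_eq, ENNReal.rpow_eq_zero_iff, not_or, not_and]
      exact ⟨fun h => absurd h h0, fun h => absurd h hA⟩
    have h2 : A ^ (1 - s) ≠ ∞ := ENNReal.rpow_ne_top_of_nonneg (by linarith) hA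
    rw [← ENNReal.mul_le_mul_iff_right h1 h2, ← ENNReal.rpow_add_of_nonneg _ _ (by linarith) hs.le]
    calc A ^ (1 - s + s) = A := by simp
      _ ≤ C * (A ^ (1 - s) * J) := key
      _ = _ := by ring
  exact (ENNReal.rpow_le_rpow hUx hs.le).trans hAs

lemma conv_shift {n : ℕ} (g : EE n → ℝ≥0∞) (v : EE n → ℝ≥0∞)
    (hv : ∀ x y z, v (x - y) * v (y - z) ≤ v (x - z)) (hvt : ∀ x, v x ≠ ∞) (x y : EE n) :
    (∫⁻ z, g z * v (y - z)) * v (x - y) ≤ ∫⁻ z, g z * v (x - z) := by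
  rw [← lintegral_mul_const' _ _ (hvt _)]
  refine lintegral_mono fun z => ?_
  calc g z * v (y - z) * v (x - y) = g z * (v (x - y) * v (y - z)) := by ring
    _ ≤ _ := by gcongr; exact hv _ _ _

lemma key_lt_one {n : ℕ} (φ : SchwartzMap (EE n) ℂ) {s : ℝ} (hs : 0 < s) (hs1 : s < 1) (M : ℕ) :
    ∃ C : ℝ≥0∞, C ≠ ∞ ∧ ∀ U, Rep φ U → ∀ x,
      (U x) ^ s ≤ C * ∫⁻ z, U z ^ s * W (x - z) ^ M := by
  obtain ⟨N, hN⟩ := exists_nat_ge (M / s)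
  have hNM : (M : ℝ) ≤ N * s := (div_le_iff₀ hs).1 hN
  have hWNM : ∀ x : EE n, (W x ^ N) ^ s ≤ W x ^ M := by
    intro x
    rw [← ENNReal.rpow_natCast, ← ENNReal.rpow_natCast, ← ENNReal.rpow_mul]
    exact ENNReal.rpow_le_rpow_of_exponent_ge (W_le_one x) hNM
  obtain ⟨C, hC, h⟩ := step_one φ hs hs1 N
  have hv : ∀ x y z : EE n, (W (x - y) ^ N) ^ s * (W (y - z) ^ N) ^ s ≤ (W (x - z) ^ N) ^ s := by
    intro x y z
    rw [← ENNReal.mul_rpow_of_nonneg _ _ hs.le]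
    exact ENNReal.rpow_le_rpow (W_sub_pow N x y z) hs.le
  have hvt : ∀ x : EE n, (W x ^ N) ^ s ≠ ∞ := fun x =>
    ENNReal.rpow_ne_top_of_nonneg hs.le (ENNReal.pow_ne_top (W_ne_top _))
  refine ⟨max C 1, by simp [hC], fun U hU x => ?_⟩
  suffices hmain : (U x) ^ s ≤ max C 1 * ∫⁻ z, U z ^ s * (W (x - z) ^ N) ^ s by
    refine hmain.trans ?_
    gcongr with z
    exact hWNM _
  rcases eq_or_ne (∫⁻ z, U z ^ s * (W (x - z) ^ N) ^ s) ∞ with hJ | hJ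
  · rw [hJ, ENNReal.mul_top (by simp)]
    exact le_top
  obtain ⟨A, k, hA, hAU⟩ := hU.2.2
  obtain ⟨C', hC', h'⟩ := step_one φ hs hs1 (max k N)
  have hfin : ∀ y, (⨆ z, U z * W (y - z) ^ (max k N)) ≠ ∞ := by
    intro y
    have hy0 : W y ^ k ≠ 0 := pow_ne_zero _ (W_ne_zero y)
    have hyt : W y ^ k ≠ ∞ := ENNReal.pow_ne_top (W_ne_top y)
    refine ne_top_of_le_ne_top (ENNReal.div_ne_top hA hy0) (iSup_le fun z => ?_)
    rw [ENNReal.le_div_iff_mul_le (by left; exact hy0) (by left; exact hyt)]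
    calc U z * W (y - z) ^ (max k N) * W y ^ k ≤ U z * W (y - z) ^ k * W y ^ k := by
          gcongr U z * ?_ * W y ^ k
          exact W_pow_anti (le_max_left _ _) _
      _ = U z * (W (z - y) ^ k * W (y - 0) ^ k) := by rw [W_comm y z, sub_zero]; ring
      _ ≤ U z * W (z - 0) ^ k := by gcongr; exact W_sub_pow k z y 0
      _ ≤ A := by rw [sub_zero]; exact hAU z
  refine (h U hU x ?_).trans (by gcongr; exact le_max_left _ _)
  have hb : C' * ∫⁻ z, U z ^ s * (W (x - z) ^ N) ^ s ≠ ∞ := ENNReal.mul_ne_top hC' hJ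
  refine ne_top_of_le_ne_top
    (ENNReal.rpow_ne_top_of_nonneg (y := s⁻¹) (by positivity) hb) (iSup_le fun y => ?_)
  rw [ENNReal.le_rpow_inv_iff hs, ENNReal.mul_rpow_of_nonneg _ _ hs.le]
  calc U y ^ s * (W (x - y) ^ N) ^ s
      ≤ (C' * ∫⁻ z, U z ^ s * (W (y - z) ^ (max k N)) ^ s) * (W (x - y) ^ N) ^ s := by
        gcongr; exact h' U hU y (hfin y)
    _ ≤ (C' * ∫⁻ z, U z ^ s * (W (y - z) ^ N) ^ s) * (W (x - y) ^ N) ^ s := by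
        refine mul_le_mul_left (mul_le_mul_right (lintegral_mono fun z => ?_) _) _
        refine mul_le_mul_right (ENNReal.rpow_le_rpow ?_ hs.le) _
        exact W_pow_anti (le_max_right _ _) _
    _ = C' * ((∫⁻ z, U z ^ s * (W (y - z) ^ N) ^ s) * (W (x - y) ^ N) ^ s) := by ring
    _ ≤ _ := by
        gcongr
        exact conv_shift (fun z => U z ^ s) (fun z => (W z ^ N) ^ s) hv hvt x y

lemma key_ge_one {n : ℕ} (φ : SchwartzMap (EE n) ℂ) {s : ℝ} (hs1 : 1 ≤ s) {M : ℕ} (hM : n < M) :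
    ∃ C : ℝ≥0∞, C ≠ ∞ ∧ ∀ U, Rep φ U → ∀ x,
      (U x) ^ s ≤ C * ∫⁻ z, U z ^ s * W (x - z) ^ M := by
  have hs : 0 < s := by linarith
  obtain ⟨C, hC, hφ⟩ := schwartz_bound φ M
  have hinv : s⁻¹ ≤ 1 := inv_le_one_of_one_le₀ hs1
  refine ⟨(C * (∫⁻ x : EE n, W x ^ M) ^ (1 - s⁻¹)) ^ s, ?_, fun U hU x => ?_⟩
  · apply ENNReal.rpow_ne_top_of_nonneg hs.le
    exact ENNReal.mul_ne_top hC (ENNReal.rpow_ne_top_of_nonneg (by linarith) (W_int hM))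
  have hWm : Measurable fun z => W (x - z) := W_meas.comp (by fun_prop)
  have hUm : Measurable U := hU.1.measurable
  have h1 : U x ≤ C * (∫⁻ x : EE n, W x ^ M) ^ (1 - s⁻¹) *
      (∫⁻ z, U z ^ s * W (x - z) ^ M) ^ s⁻¹ := by
    calc U x ≤ ∫⁻ y, U y * ‖φ (x - y)‖ₑ := hU.2.1 x
      _ ≤ ∫⁻ y, C * ((U y ^ s * W (x - y) ^ M) ^ s⁻¹ * (W (x - y) ^ M) ^ (1 - s⁻¹)) := by
          refine lintegral_mono fun y => ?_
          rw [ENNReal.mul_rpow_of_nonneg _ _ (by positivity), mul_assoc,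
            ← ENNReal.rpow_add_of_nonneg _ _ (by positivity) (by linarith), ENNReal.rpow_rpow_inv hs.ne']
          simp only [add_sub_cancel, ENNReal.rpow_one]
          calc U y * ‖φ (x - y)‖ₑ ≤ U y * (C * W (x - y) ^ M) := by gcongr; exact hφ _
            _ = _ := by ring
      _ = C * ∫⁻ y, ((U y ^ s * W (x - y) ^ M) ^ s⁻¹ * (W (x - y) ^ M) ^ (1 - s⁻¹)) := by
          rw [lintegral_const_mul _ (by fun_prop)]
      _ ≤ C * ((∫⁻ z, U z ^ s * W (x - z) ^ M) ^ s⁻¹ *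
            (∫⁻ y, W (x - y) ^ M) ^ (1 - s⁻¹)) := by
          gcongr
          exact ENNReal.lintegral_mul_norm_pow_le (by fun_prop)
            (hWm.pow_const M).aemeasurable (by positivity)
            (by linarith) (by ring)
      _ = _ := by
          rw [lintegral_sub_left_eq_self (fun y => W y ^ M) x]
          ring
  calc U x ^ s ≤ _ := ENNReal.rpow_le_rpow h1 hs.le
    _ = _ := by
      rw [ENNReal.mul_rpow_of_nonneg _ _ hs.le, ENNReal.rpow_inv_rpow hs.ne']

def Good {n : ℕ} (𝒢 : Set (EE n → ℝ≥0∞)) : Prop :=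
  (∀ g ∈ 𝒢, Measurable g) ∧ ∀ s : ℝ, 0 < s → ∃ C : ℝ≥0∞, C ≠ ∞ ∧ ∀ g ∈ 𝒢, ∀ x,
    g x ^ s ≤ C * ∫⁻ z, g z ^ s * W (x - z) ^ (n + 1)

lemma good_rep {n : ℕ} (φ : SchwartzMap (EE n) ℂ) {α : ℝ} (hα : 0 < α) :
    Good {g | ∃ U, Rep φ U ∧ g = fun x => U x ^ α} := by
  constructor
  · rintro g ⟨U, hU, rfl⟩
    exact hU.1.measurable.pow_const _
  · intro s hs
    have : ∃ C : ℝ≥0∞, C ≠ ∞ ∧ ∀ U, Rep φ U → ∀ x,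
      (U x) ^ (α * s) ≤ C * ∫⁻ z, U z ^ (α * s) * W (x - z) ^ (n + 1) := by
      rcases lt_or_ge (α * s) 1 with h | h
      · exact key_lt_one φ (by positivity) h _
      · exact key_ge_one φ h (by omega)
    obtain ⟨C, hC, h⟩ := this
    refine ⟨C, hC, ?_⟩
    rintro g ⟨U, hU, rfl⟩ x
    simpa only [← ENNReal.rpow_mul] using h U hU x


/-- The `L^p` (quasi)norm for a finite real exponent. -/
noncomputable def L {n : ℕ} (g : EE n → ℝ≥0∞) (p : ℝ) : ℝ≥0∞ := (∫⁻ x, g x ^ p) ^ p⁻¹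

lemma eLpNorm_eq_L {n : ℕ} (g : EE n → ℝ≥0∞) {p : ℝ≥0∞} (h0 : p ≠ 0) (ht : p ≠ ∞) :
    eLpNorm g p volume = L g p.toReal := by
  rw [eLpNorm_eq_lintegral_rpow_enorm_toReal h0 ht, L, one_div]
  simp

lemma sup_bound {n : ℕ} {𝒢 : Set (EE n → ℝ≥0∞)} (h𝒢 : Good 𝒢) {p : ℝ} (hp : 0 < p) :
    ∃ C : ℝ≥0∞, C ≠ ∞ ∧ ∀ g ∈ 𝒢, ∀ x, g x ≤ C * L g p := by
  obtain ⟨C, hC, h⟩ := h𝒢.2 p hp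
  refine ⟨C ^ p⁻¹, ENNReal.rpow_ne_top_of_nonneg (by positivity) hC, fun g hg x => ?_⟩
  rw [L, ← ENNReal.mul_rpow_of_nonneg _ _ (by positivity), ENNReal.le_rpow_inv_iff hp]
  refine (h g hg x).trans ?_
  gcongr with z
  exact mul_le_of_le_one_right' (pow_le_one' (W_le_one _) _)

lemma embed_real {n : ℕ} {𝒢 : Set (EE n → ℝ≥0∞)} (h𝒢 : Good 𝒢) {p r : ℝ} (hp : 0 < p)
    (hpr : p ≤ r) : ∃ C : ℝ≥0∞, C ≠ ∞ ∧ ∀ g ∈ 𝒢, L g r ≤ C * L g p := by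
  obtain ⟨C, hC, h⟩ := sup_bound h𝒢 hp
  have hr : 0 < r := by linarith
  refine ⟨(C ^ (r - p)) ^ r⁻¹, ENNReal.rpow_ne_top_of_nonneg (by positivity)
    (ENNReal.rpow_ne_top_of_nonneg (by linarith) hC), fun g hg => ?_⟩
  have hgm := h𝒢.1 g hg
  rw [L, ENNReal.rpow_inv_le_iff hr, ENNReal.mul_rpow_of_nonneg _ _ hr.le,
    ENNReal.rpow_inv_rpow hr.ne']
  calc ∫⁻ x, g x ^ r ≤ ∫⁻ x, (C * L g p) ^ (r - p) * g x ^ p := by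
        refine lintegral_mono fun x => ?_
        calc g x ^ r = g x ^ (r - p) * g x ^ p := by
              rw [← ENNReal.rpow_add_of_nonneg _ _ (by linarith) hp.le]; simp
          _ ≤ _ := by
              gcongr
              exact h g hg x
    _ = (C * L g p) ^ (r - p) * (L g p) ^ p := by
        rw [lintegral_const_mul _ (by fun_prop)]
        simp only [L]
        rw [ENNReal.rpow_inv_rpow hp.ne']
    _ = _ := by
        rw [ENNReal.mul_rpow_of_nonneg _ _ (by linarith), mul_assoc,
          ← ENNReal.rpow_add_of_nonneg _ _ (by linarith) hp.le]
        simp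

lemma embed_L {n : ℕ} {𝒢 : Set (EE n → ℝ≥0∞)} (h𝒢 : Good 𝒢) {p : ℝ≥0∞} {r : ℝ} (hp : 0 < p)
    (hpt : p ≠ ∞) (hpr : p.toReal ≤ r) :
    ∃ C : ℝ≥0∞, C ≠ ∞ ∧ ∀ g ∈ 𝒢, L g r ≤ C * eLpNorm g p volume := by
  simp only [eLpNorm_eq_L _ hp.ne' hpt]
  exact embed_real h𝒢 (ENNReal.toReal_pos hp.ne' hpt) hpr

lemma embed_top {n : ℕ} {𝒢 : Set (EE n → ℝ≥0∞)} (h𝒢 : Good 𝒢) {p : ℝ≥0∞} (hp : 0 < p) :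
    ∃ C : ℝ≥0∞, C ≠ ∞ ∧ ∀ g ∈ 𝒢, eLpNorm g ∞ volume ≤ C * eLpNorm g p volume := by
  by_cases hpt : p = ∞
  · exact ⟨1, one_ne_top, fun g _ => by rw [hpt, one_mul]⟩
  · simp only [eLpNorm_eq_L _ hp.ne' hpt]
    obtain ⟨C, hC, h⟩ := sup_bound h𝒢 (ENNReal.toReal_pos hp.ne' hpt)
    refine ⟨C, hC, fun g hg => ?_⟩
    rw [eLpNorm_exponent_top, eLpNormEssSup]
    exact essSup_le_of_ae_le _ (Filter.Eventually.of_forall fun x => by simpa using h g hg x)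

lemma conv_int {n : ℕ} {f g : EE n → ℝ≥0∞} (hf : Measurable f) (hg : Measurable g) :
    ∫⁻ x, ∫⁻ y, f y * g (y - x) = (∫⁻ x, f x) * ∫⁻ x, g x := by
  rw [lintegral_lintegral_swap (by
    exact ((hf.comp measurable_snd).mul (hg.comp (measurable_snd.sub measurable_fst))).aemeasurable)]
  have : ∀ y, ∫⁻ x, f y * g (y - x) = f y * ∫⁻ x, g x := fun y => by
    rw [lintegral_const_mul _ (by fun_prop), lintegral_sub_left_eq_self g y]
  simp only [this]
  rw [lintegral_mul_const _ hf]

lemma conv_W_int {n : ℕ} {g : EE n → ℝ≥0∞} (hg : Measurable g) (M : ℕ) :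
    ∫⁻ x, ∫⁻ z, g z * W (x - z) ^ M = (∫⁻ x, g x) * ∫⁻ x : EE n, W x ^ M := by
  rw [← conv_int hg (W_meas.pow_const M)]
  refine lintegral_congr fun x => lintegral_congr fun z => ?_
  rw [W_comm]

lemma conv_W_meas {n : ℕ} {g : EE n → ℝ≥0∞} (hg : Measurable g) (M : ℕ) :
    Measurable fun x => ∫⁻ z, g z * W (x - z) ^ M := by
  apply Measurable.lintegral_prod_right
  exact (hg.comp measurable_snd).mul
    ((W_meas.comp (measurable_fst.sub measurable_snd)).pow_const M)

/-- Slowly varying functions satisfy a reverse Hölder inequality. -/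
lemma slow {n : ℕ} {M : ℕ} (hM : n < M) {p : ℝ} (hp : 0 < p) (hp1 : p ≤ 1) :
    ∃ C : ℝ≥0∞, C ≠ ∞ ∧ ∀ H : EE n → ℝ≥0∞, Measurable H →
      (∀ x y, H y * W (x - y) ^ M ≤ H x) → (∫⁻ y, H y ^ p⁻¹) ^ p ≤ C * ∫⁻ y, H y := by
  set c := ∫⁻ x : EE n, W x ^ M with hc
  have hc0 : c ≠ 0 := W_int_pos
  have hct : c ≠ ∞ := W_int hM
  have hp1' : 1 ≤ p⁻¹ := (one_le_inv₀ hp).2 hp1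
  refine ⟨((c⁻¹) ^ (p⁻¹ - 1)) ^ p, ENNReal.rpow_ne_top_of_nonneg hp.le
    (ENNReal.rpow_ne_top_of_nonneg (by linarith) (by simp [hc0])), fun H hH h => ?_⟩
  set I := ∫⁻ y, H y with hI
  have hsup : ∀ y, H y ≤ c⁻¹ * I := by
    intro y
    rw [mul_comm, ← div_eq_mul_inv, ENNReal.le_div_iff_mul_le (by left; exact hc0)
      (by left; exact hct)]
    calc H y * c = H y * ∫⁻ x, W (x - y) ^ M := by
          rw [hc, lintegral_sub_right_eq_self (fun x => W x ^ M) y]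
      _ = ∫⁻ x, H y * W (x - y) ^ M := by
          rw [lintegral_const_mul]
          exact (W_meas.comp (by fun_prop)).pow_const M
      _ ≤ I := lintegral_mono fun x => h x y
  rw [← ENNReal.le_rpow_inv_iff hp, ENNReal.mul_rpow_of_nonneg _ _ (by positivity),
    ENNReal.rpow_rpow_inv hp.ne']
  calc ∫⁻ y, H y ^ p⁻¹ ≤ ∫⁻ y, (c⁻¹ * I) ^ (p⁻¹ - 1) * H y := by
        refine lintegral_mono fun y => ?_
        calc H y ^ p⁻¹ = H y ^ (p⁻¹ - 1) * H y ^ (1 : ℝ) := by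
              rw [← ENNReal.rpow_add_of_nonneg _ _ (by linarith) zero_le_one]; simp
          _ ≤ _ := by
              rw [ENNReal.rpow_one]
              gcongr
              exact hsup y
    _ = (c⁻¹ * I) ^ (p⁻¹ - 1) * I ^ (1 : ℝ) := by
        rw [lintegral_const_mul _ hH, ENNReal.rpow_one]
    _ = _ := by
        rw [ENNReal.mul_rpow_of_nonneg _ _ (by linarith), mul_assoc,
          ← ENNReal.rpow_add_of_nonneg _ _ (by linarith) zero_le_one]
        simp

lemma young_lt {n : ℕ} {𝒢₁ 𝒢₂ : Set (EE n → ℝ≥0∞)} (h₁ : Good 𝒢₁) (h₂ : Good 𝒢₂) {p : ℝ}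
    (hp : 0 < p) (hp1 : p ≤ 1) :
    ∃ C : ℝ≥0∞, C ≠ ∞ ∧ ∀ g₁ ∈ 𝒢₁, ∀ g₂ ∈ 𝒢₂,
      (∫⁻ x, (∫⁻ y, g₁ y * g₂ (y - x)) ^ p) ^ p⁻¹ ≤ C * L g₁ p * L g₂ p := by
  obtain ⟨C₁, hC₁, b₁⟩ := h₁.2 p hp
  obtain ⟨C₂, hC₂, b₂⟩ := h₂.2 p hp
  obtain ⟨C₃, hC₃, b₃⟩ := slow (n := n) (M := (n + 1) + (n + 1)) (by omega) hp hp1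
  set c := ∫⁻ x : EE n, W x ^ (n + 1) with hc
  have hct : c ≠ ∞ := W_int (by omega)
  refine ⟨(C₁ * C₂ * C₃ * c * c) ^ p⁻¹, ENNReal.rpow_ne_top_of_nonneg (by positivity) ?_,
    fun g₁ hg₁ g₂ hg₂ => ?_⟩
  · exact ENNReal.mul_ne_top (ENNReal.mul_ne_top (ENNReal.mul_ne_top
      (ENNReal.mul_ne_top hC₁ hC₂) hC₃) hct) hct
  have m₁ := h₁.1 g₁ hg₁
  have m₂ := h₂.1 g₂ hg₂
  simp only [L]
  rw [← ENNReal.mul_rpow_of_nonneg _ _ (by positivity),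
    ← ENNReal.mul_rpow_of_nonneg _ _ (by positivity)]
  apply ENNReal.rpow_le_rpow _ (by positivity)
  set G₁ : EE n → ℝ≥0∞ := fun x => ∫⁻ z, g₁ z ^ p * W (x - z) ^ (n + 1) with hG₁
  set G₂ : EE n → ℝ≥0∞ := fun x => ∫⁻ z, g₂ z ^ p * W (x - z) ^ (n + 1) with hG₂
  have mG₁ : Measurable G₁ := conv_W_meas (m₁.pow_const p) _
  have mG₂ : Measurable G₂ := conv_W_meas (m₂.pow_const p) _
  have s₁ : ∀ x y, G₁ y * W (x - y) ^ (n + 1) ≤ G₁ x := fun x y =>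
    conv_shift (fun z => g₁ z ^ p) (fun z => W z ^ (n + 1)) (W_sub_pow _)
      (fun z => ENNReal.pow_ne_top (W_ne_top z)) x y
  have s₂ : ∀ x y, G₂ y * W (x - y) ^ (n + 1) ≤ G₂ x := fun x y =>
    conv_shift (fun z => g₂ z ^ p) (fun z => W z ^ (n + 1)) (W_sub_pow _)
      (fun z => ENNReal.pow_ne_top (W_ne_top z)) x y
  have hpt : ∀ x, (∫⁻ y, g₁ y * g₂ (y - x)) ^ p ≤
      (C₁ * C₂ * C₃) * ∫⁻ y, G₁ y * G₂ (y - x) := by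
    intro x
    have mH : Measurable fun y => G₁ y * G₂ (y - x) :=
      mG₁.mul (mG₂.comp (by fun_prop))
    calc (∫⁻ y, g₁ y * g₂ (y - x)) ^ p
        ≤ (∫⁻ y, (C₁ * C₂) ^ p⁻¹ * (G₁ y * G₂ (y - x)) ^ p⁻¹) ^ p := by
          apply ENNReal.rpow_le_rpow _ hp.le
          refine lintegral_mono fun y => ?_
          rw [← ENNReal.mul_rpow_of_nonneg _ _ (by positivity), ENNReal.le_rpow_inv_iff hp,
            ENNReal.mul_rpow_of_nonneg _ _ hp.le]
          calc g₁ y ^ p * g₂ (y - x) ^ p ≤ (C₁ * G₁ y) * (C₂ * G₂ (y - x)) :=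
                mul_le_mul' (b₁ g₁ hg₁ y) (b₂ g₂ hg₂ (y - x))
            _ = _ := by ring
      _ = (C₁ * C₂) * (∫⁻ y, (G₁ y * G₂ (y - x)) ^ p⁻¹) ^ p := by
          rw [lintegral_const_mul _ (mH.pow_const _), ENNReal.mul_rpow_of_nonneg _ _ hp.le,
            ENNReal.rpow_inv_rpow hp.ne']
      _ ≤ (C₁ * C₂) * (C₃ * ∫⁻ y, G₁ y * G₂ (y - x)) := by
          gcongr
          refine b₃ _ mH fun a b => ?_
          calc G₁ b * G₂ (b - x) * W (a - b) ^ (n + 1 + (n + 1))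
              = (G₁ b * W (a - b) ^ (n + 1)) *
                (G₂ (b - x) * W ((a - x) - (b - x)) ^ (n + 1)) := by
                rw [sub_sub_sub_cancel_right, pow_add]; ring
            _ ≤ _ := mul_le_mul' (s₁ a b) (s₂ _ _)
      _ = _ := by ring
  calc ∫⁻ x, (∫⁻ y, g₁ y * g₂ (y - x)) ^ p
      ≤ ∫⁻ x, (C₁ * C₂ * C₃) * ∫⁻ y, G₁ y * G₂ (y - x) := lintegral_mono hpt
    _ = (C₁ * C₂ * C₃) * ∫⁻ x, ∫⁻ y, G₁ y * G₂ (y - x) := by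
        rw [lintegral_const_mul']
        exact ENNReal.mul_ne_top (ENNReal.mul_ne_top hC₁ hC₂) hC₃
    _ = (C₁ * C₂ * C₃) * (((∫⁻ x, g₁ x ^ p) * c) * ((∫⁻ x, g₂ x ^ p) * c)) := by
        rw [conv_int mG₁ mG₂, hG₁, hG₂, conv_W_int (m₁.pow_const p), conv_W_int (m₂.pow_const p)]
    _ = _ := by ring

lemma young_pt {n : ℕ} {g₁ g₂ : EE n → ℝ≥0∞} (m₁ : Measurable g₁) (m₂ : Measurable g₂)
    {a r₁ r₂ : ℝ} (ha : 0 ≤ a) (hr₁ : 0 < r₁) (hr₂ : 0 < r₂) (h₁ : a ≤ r₁⁻¹) (h₂ : a ≤ r₂⁻¹)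
    (h : r₁⁻¹ + r₂⁻¹ = 1 + a) (x : EE n) :
    ∫⁻ y, g₁ y * g₂ (y - x) ≤ (∫⁻ y, g₁ y ^ r₁ * g₂ (y - x) ^ r₂) ^ a *
      ((∫⁻ y, g₁ y ^ r₁) ^ (r₁⁻¹ - a) * (∫⁻ y, g₂ y ^ r₂) ^ (r₂⁻¹ - a)) := by
  have hs : Measurable fun y => g₂ (y - x) := m₂.comp (by fun_prop)
  have key := ENNReal.lintegral_prod_norm_pow_le (μ := (volume : Measure (EE n)))
    (Finset.univ : Finset (Fin 3))
    (f := ![fun y => g₁ y ^ r₁ * g₂ (y - x) ^ r₂, fun y => g₁ y ^ r₁, fun y => g₂ (y - x) ^ r₂])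
    (p := ![a, r₁⁻¹ - a, r₂⁻¹ - a])
    (by
      intro i _
      fin_cases i
      · exact ((m₁.pow_const _).mul (hs.pow_const _)).aemeasurable
      · exact (m₁.pow_const _).aemeasurable
      · exact (hs.pow_const _).aemeasurable)
    (by simp [Fin.sum_univ_three]; linarith)
    (by
      intro i _
      fin_cases i <;> simp <;> linarith)
  simp only [Fin.prod_univ_three, Matrix.cons_val_zero, Matrix.cons_val_one, Matrix.cons_val] at key
  rw [lintegral_sub_right_eq_self (fun y => g₂ y ^ r₂) x] at key
  rw [← mul_assoc]
  refine le_trans (le_of_eq ?_) key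
  refine lintegral_congr fun y => ?_
  have e : ∀ (t : ℝ≥0∞) (r : ℝ), 0 < r → a ≤ r⁻¹ → (t ^ r) ^ a * (t ^ r) ^ (r⁻¹ - a) = t := by
    intro t r hr har
    rw [← ENNReal.rpow_add_of_nonneg _ _ ha (by linarith), add_sub_cancel,
      ENNReal.rpow_rpow_inv hr.ne']
  rw [ENNReal.mul_rpow_of_nonneg _ _ ha]
  calc g₁ y * g₂ (y - x) = ((g₁ y ^ r₁) ^ a * (g₁ y ^ r₁) ^ (r₁⁻¹ - a)) *
        ((g₂ (y - x) ^ r₂) ^ a * (g₂ (y - x) ^ r₂) ^ (r₂⁻¹ - a)) := by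
        rw [e _ _ hr₁ h₁, e _ _ hr₂ h₂]
    _ = _ := by ring

lemma young_ge {n : ℕ} {g₁ g₂ : EE n → ℝ≥0∞} (m₁ : Measurable g₁) (m₂ : Measurable g₂)
    {p r₁ r₂ : ℝ} (hp : 0 < p) (hr₁ : 0 < r₁) (hr₂ : 0 < r₂) (h₁ : p⁻¹ ≤ r₁⁻¹) (h₂ : p⁻¹ ≤ r₂⁻¹)
    (h : r₁⁻¹ + r₂⁻¹ = 1 + p⁻¹) :
    (∫⁻ x, (∫⁻ y, g₁ y * g₂ (y - x)) ^ p) ^ p⁻¹ ≤ L g₁ r₁ * L g₂ r₂ := by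
  rw [ENNReal.rpow_inv_le_iff hp]
  simp only [L]
  set I₁ := ∫⁻ y, g₁ y ^ r₁ with hI₁
  set I₂ := ∫⁻ y, g₂ y ^ r₂ with hI₂
  have mm : Measurable fun x => ∫⁻ y, g₁ y ^ r₁ * g₂ (y - x) ^ r₂ := by
    apply Measurable.lintegral_prod_right
    exact ((m₁.comp measurable_snd).pow_const _).mul
      ((m₂.comp (measurable_snd.sub measurable_fst)).pow_const _)
  have e : ∀ (t : ℝ≥0∞) (r : ℝ), 0 < r → p⁻¹ ≤ r⁻¹ → t * (t ^ (r⁻¹ - p⁻¹)) ^ p = (t ^ r⁻¹) ^ p := by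
    intro t r hr hpr
    have : 0 ≤ (r⁻¹ - p⁻¹) * p := mul_nonneg (by linarith) hp.le
    rw [← ENNReal.rpow_mul, ← ENNReal.rpow_mul]
    nth_rewrite 1 [← ENNReal.rpow_one t]
    rw [← ENNReal.rpow_add_of_nonneg _ _ zero_le_one this]
    congr 1
    field_simp
    ring
  calc ∫⁻ x, (∫⁻ y, g₁ y * g₂ (y - x)) ^ p
      ≤ ∫⁻ x, (∫⁻ y, g₁ y ^ r₁ * g₂ (y - x) ^ r₂) *
          (I₁ ^ (r₁⁻¹ - p⁻¹) * I₂ ^ (r₂⁻¹ - p⁻¹)) ^ p := by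
        refine lintegral_mono fun x => ?_
        refine (ENNReal.rpow_le_rpow (young_pt m₁ m₂ (a := p⁻¹) (by positivity) hr₁ hr₂ h₁ h₂ h x)
          hp.le).trans (le_of_eq ?_)
        rw [ENNReal.mul_rpow_of_nonneg _ _ hp.le, ENNReal.rpow_inv_rpow hp.ne']
    _ = I₁ * I₂ * (I₁ ^ (r₁⁻¹ - p⁻¹) * I₂ ^ (r₂⁻¹ - p⁻¹)) ^ p := by
        rw [lintegral_mul_const _ mm, conv_int (m₁.pow_const r₁) (m₂.pow_const r₂)]
    _ = (I₁ * (I₁ ^ (r₁⁻¹ - p⁻¹)) ^ p) * (I₂ * (I₂ ^ (r₂⁻¹ - p⁻¹)) ^ p) := by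
        rw [ENNReal.mul_rpow_of_nonneg _ _ hp.le]; ring
    _ = _ := by
        rw [e _ _ hr₁ h₁, e _ _ hr₂ h₂, ENNReal.mul_rpow_of_nonneg _ _ hp.le]

lemma holder_one_top {n : ℕ} (f : EE n → ℝ≥0∞) {g : EE n → ℝ≥0∞} (mf : Measurable f) :
    ∫⁻ y, f y * g y ≤ L f 1 * eLpNorm g ∞ volume := by
  have : L f 1 = ∫⁻ y, f y := by simp [L]
  rw [this, ← lintegral_mul_const _ mf]
  apply lintegral_mono_ae
  filter_upwards [enorm_ae_le_eLpNormEssSup g volume] with y hy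
  rw [eLpNorm_exponent_top]
  gcongr
  simpa using hy

lemma conj_real {p₁ p₂ p₃ : ℝ≥0∞}
    (hconj : (1 - (max 1 p₁)⁻¹) + (1 - (max 1 p₂)⁻¹) ≤ 1 - (max 1 p₃)⁻¹) :
    1 + ((max 1 p₃)⁻¹).toReal ≤ ((max 1 p₁)⁻¹).toReal + ((max 1 p₂)⁻¹).toReal := by
  have hle : ∀ p : ℝ≥0∞, (max 1 p)⁻¹ ≤ 1 := fun p => by simp [ENNReal.inv_le_one]
  have h := ENNReal.toReal_mono (by simp) hconj
  rw [ENNReal.toReal_add (by simp) (by simp), ENNReal.toReal_sub_of_le (hle _) one_ne_top,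
    ENNReal.toReal_sub_of_le (hle _) one_ne_top, ENNReal.toReal_sub_of_le (hle _) one_ne_top] at h
  simp only [ENNReal.toReal_one] at h
  linarith

lemma toReal_max_inv {p : ℝ≥0∞} (hp : p ≠ ∞) :
    ((max 1 p)⁻¹).toReal = (max 1 p.toReal)⁻¹ := by
  rw [ENNReal.toReal_inv, ENNReal.toReal_max one_ne_top hp, ENNReal.toReal_one]

lemma le_one_of_top {p₁ p₂ p₃ : ℝ≥0∞} (hp₁ : p₁ = ∞)
    (h : 1 + ((max 1 p₃)⁻¹).toReal ≤ ((max 1 p₁)⁻¹).toReal + ((max 1 p₂)⁻¹).toReal) : p₂ ≤ 1 := by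
  have h0 : 0 ≤ ((max 1 p₃)⁻¹).toReal := ENNReal.toReal_nonneg
  subst hp₁
  rw [max_eq_right le_top, ENNReal.inv_top, ENNReal.toReal_zero, zero_add] at h
  by_cases hp₂ : p₂ = ∞
  · subst hp₂
    rw [max_eq_right le_top, ENNReal.inv_top, ENNReal.toReal_zero] at h
    linarith
  · rw [toReal_max_inv hp₂] at h
    have h1 : 1 ≤ (max 1 p₂.toReal)⁻¹ := by linarith
    have h2 : max 1 p₂.toReal ≤ 1 := by
      rwa [one_le_inv₀ (by positivity)] at h1
    have h3 := (le_max_right 1 p₂.toReal).trans h2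
    rwa [← ENNReal.toReal_one, ENNReal.toReal_le_toReal hp₂ one_ne_top] at h3

lemma young_top {n : ℕ} {𝒢₁ 𝒢₂ : Set (EE n → ℝ≥0∞)} (h₁ : Good 𝒢₁) (h₂ : Good 𝒢₂)
    {p₁ p₂ p₃ : ℝ≥0∞} (hp₁ : 0 < p₁) (hp₂ : 0 < p₂)
    (h : 1 + ((max 1 p₃)⁻¹).toReal ≤ ((max 1 p₁)⁻¹).toReal + ((max 1 p₂)⁻¹).toReal) :
    ∃ C : ℝ≥0∞, C ≠ ∞ ∧ ∀ g₁ ∈ 𝒢₁, ∀ g₂ ∈ 𝒢₂, ∀ x,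
      ∫⁻ y, g₁ y * g₂ (y - x) ≤ C * eLpNorm g₁ p₁ volume * eLpNorm g₂ p₂ volume := by
  have t : ∀ p : ℝ≥0∞, p ≤ 1 → p.toReal ≤ 1 := fun p hp => by
    simpa using ENNReal.toReal_mono one_ne_top hp
  have h0 : 0 ≤ ((max 1 p₃)⁻¹).toReal := ENNReal.toReal_nonneg
  by_cases c₁ : p₁ ≤ 1
  · obtain ⟨C₁, hC₁, b₁⟩ := embed_L h₁ (r := 1) hp₁ (ne_top_of_le_ne_top one_ne_top c₁) (t _ c₁)
    obtain ⟨C₂, hC₂, b₂⟩ := embed_top h₂ hp₂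
    refine ⟨C₁ * C₂, ENNReal.mul_ne_top hC₁ hC₂, fun g₁ hg₁ g₂ hg₂ x => ?_⟩
    calc ∫⁻ y, g₁ y * g₂ (y - x) ≤ L g₁ 1 * eLpNorm (fun y => g₂ (y - x)) ∞ volume :=
          holder_one_top _ (h₁.1 g₁ hg₁)
      _ = L g₁ 1 * eLpNorm g₂ ∞ volume := by
          congr 1
          exact eLpNorm_comp_measurePreserving (h₂.1 g₂ hg₂).aestronglyMeasurable
            (measurePreserving_sub_right volume x)
      _ ≤ (C₁ * eLpNorm g₁ p₁ volume) * (C₂ * eLpNorm g₂ p₂ volume) :=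
          mul_le_mul' (b₁ g₁ hg₁) (b₂ g₂ hg₂)
      _ = _ := by ring
  by_cases c₂ : p₂ ≤ 1
  · obtain ⟨C₂, hC₂, b₂⟩ := embed_L h₂ (r := 1) hp₂ (ne_top_of_le_ne_top one_ne_top c₂) (t _ c₂)
    obtain ⟨C₁, hC₁, b₁⟩ := embed_top h₁ hp₁
    refine ⟨C₁ * C₂, ENNReal.mul_ne_top hC₁ hC₂, fun g₁ hg₁ g₂ hg₂ x => ?_⟩
    have m₂ := h₂.1 g₂ hg₂
    calc ∫⁻ y, g₁ y * g₂ (y - x) = ∫⁻ y, g₂ (y - x) * g₁ y := by simp only [mul_comm]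
      _ ≤ L (fun y => g₂ (y - x)) 1 * eLpNorm g₁ ∞ volume :=
          holder_one_top _ (m₂.comp (by fun_prop))
      _ = L g₂ 1 * eLpNorm g₁ ∞ volume := by
          congr 1
          simp only [L]
          rw [lintegral_sub_right_eq_self (fun y => g₂ y ^ (1 : ℝ)) x]
      _ ≤ (C₂ * eLpNorm g₂ p₂ volume) * (C₁ * eLpNorm g₁ p₁ volume) :=
          mul_le_mul' (b₂ g₂ hg₂) (b₁ g₁ hg₁)
      _ = _ := by ring
  have ht₁ : p₁ ≠ ∞ := fun hh => c₂ (le_one_of_top hh h)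
  have ht₂ : p₂ ≠ ∞ := fun hh => c₁ (le_one_of_top (p₃ := p₃) hh (by linarith))
  rw [toReal_max_inv ht₁, toReal_max_inv ht₂] at h
  have g₁ : 1 < p₁.toReal := by
    rw [← ENNReal.toReal_one]
    exact (ENNReal.toReal_lt_toReal one_ne_top ht₁).2 (not_le.1 c₁)
  have g₂ : 1 < p₂.toReal := by
    rw [← ENNReal.toReal_one]
    exact (ENNReal.toReal_lt_toReal one_ne_top ht₂).2 (not_le.1 c₂)
  rw [max_eq_right g₁.le, max_eq_right g₂.le] at h
  have i₁ : p₁.toReal⁻¹ < 1 := inv_lt_one_of_one_lt₀ g₁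
  have i₁' : 0 < p₁.toReal⁻¹ := by positivity
  obtain ⟨C₁, hC₁, b₁⟩ := embed_L h₁ (r := p₁.toReal) hp₁ ht₁ le_rfl
  obtain ⟨C₂, hC₂, b₂⟩ := embed_L h₂ (r := (1 - p₁.toReal⁻¹)⁻¹) hp₂ ht₂ (by
    rw [le_inv_comm₀ (by positivity) (by linarith)]
    linarith)
  refine ⟨C₁ * C₂, ENNReal.mul_ne_top hC₁ hC₂, fun g₁ hg₁ g₂ hg₂ x => ?_⟩
  have key := young_pt (h₁.1 g₁ hg₁) (h₂.1 g₂ hg₂) (a := 0) (r₁ := p₁.toReal)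
    (r₂ := (1 - p₁.toReal⁻¹)⁻¹) le_rfl (by positivity) (inv_pos.2 (by linarith))
    (by positivity) (by rw [inv_inv]; linarith) (by rw [inv_inv]; ring) x
  simp only [ENNReal.rpow_zero, one_mul, sub_zero] at key
  calc _ ≤ L g₁ p₁.toReal * L g₂ (1 - p₁.toReal⁻¹)⁻¹ := key
    _ ≤ (C₁ * eLpNorm g₁ p₁ volume) * (C₂ * eLpNorm g₂ p₂ volume) :=
          mul_le_mul' (b₁ g₁ hg₁) (b₂ g₂ hg₂)
    _ = _ := by ring

lemma young_fin {n : ℕ} {𝒢₁ 𝒢₂ : Set (EE n → ℝ≥0∞)} (h₁ : Good 𝒢₁) (h₂ : Good 𝒢₂)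
    {p₁ p₂ p₃ : ℝ≥0∞} (hp₁ : 0 < p₁) (hp₂ : 0 < p₂) (h₁₃ : p₁ ≤ p₃) (h₂₃ : p₂ ≤ p₃)
    (hp₃ : p₃ ≠ ∞)
    (h : 1 + ((max 1 p₃)⁻¹).toReal ≤ ((max 1 p₁)⁻¹).toReal + ((max 1 p₂)⁻¹).toReal) :
    ∃ C : ℝ≥0∞, C ≠ ∞ ∧ ∀ g₁ ∈ 𝒢₁, ∀ g₂ ∈ 𝒢₂,
      (∫⁻ x, (∫⁻ y, g₁ y * g₂ (y - x)) ^ p₃.toReal) ^ p₃.toReal⁻¹ ≤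
        C * eLpNorm g₁ p₁ volume * eLpNorm g₂ p₂ volume := by
  have ht₁ : p₁ ≠ ∞ := ne_top_of_le_ne_top hp₃ h₁₃
  have ht₂ : p₂ ≠ ∞ := ne_top_of_le_ne_top hp₃ h₂₃
  have q₁ : p₁.toReal ≤ p₃.toReal := ENNReal.toReal_mono hp₃ h₁₃
  have q₂ : p₂.toReal ≤ p₃.toReal := ENNReal.toReal_mono hp₃ h₂₃
  have z₁ : 0 < p₁.toReal := ENNReal.toReal_pos hp₁.ne' ht₁
  have z₂ : 0 < p₂.toReal := ENNReal.toReal_pos hp₂.ne' ht₂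
  have z₃ : 0 < p₃.toReal := by linarith
  rw [toReal_max_inv ht₁, toReal_max_inv ht₂, toReal_max_inv hp₃] at h
  rcases le_total p₃.toReal 1 with c | c
  · obtain ⟨C₁, hC₁, b₁⟩ := embed_L h₁ (r := p₃.toReal) hp₁ ht₁ q₁
    obtain ⟨C₂, hC₂, b₂⟩ := embed_L h₂ (r := p₃.toReal) hp₂ ht₂ q₂
    obtain ⟨C₃, hC₃, b₃⟩ := young_lt h₁ h₂ z₃ c
    refine ⟨C₃ * C₁ * C₂, ENNReal.mul_ne_top (ENNReal.mul_ne_top hC₃ hC₁) hC₂,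
      fun g₁ hg₁ g₂ hg₂ => ?_⟩
    calc _ ≤ C₃ * L g₁ p₃.toReal * L g₂ p₃.toReal := b₃ g₁ hg₁ g₂ hg₂
      _ ≤ C₃ * (C₁ * eLpNorm g₁ p₁ volume) * (C₂ * eLpNorm g₂ p₂ volume) :=
          mul_le_mul' (mul_le_mul' le_rfl (b₁ g₁ hg₁)) (b₂ g₂ hg₂)
      _ = _ := by ring
  · rw [max_eq_right c] at h
    set r₁ := max 1 p₁.toReal with hr₁
    set s₂ := max 1 p₂.toReal with hs₂
    have e₁ : 1 ≤ r₁ := le_max_left _ _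
    have e₂ : 1 ≤ s₂ := le_max_left _ _
    have e₃ : r₁ ≤ p₃.toReal := max_le c q₁
    have i₁ : r₁⁻¹ ≤ 1 := inv_le_one_of_one_le₀ e₁
    have i₃ : p₃.toReal⁻¹ ≤ r₁⁻¹ := inv_anti₀ (by linarith) e₃
    have z₃' : 0 < p₃.toReal⁻¹ := by positivity
    set b := 1 + p₃.toReal⁻¹ - r₁⁻¹ with hb
    have hb0 : 0 < b := by linarith
    have hbs : s₂ ≤ b⁻¹ := by
      rw [le_inv_comm₀ (by linarith) hb0]
      linarith
    obtain ⟨C₁, hC₁, b₁⟩ := embed_L h₁ (r := r₁) hp₁ ht₁ (le_max_right _ _)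
    obtain ⟨C₂, hC₂, b₂⟩ := embed_L h₂ (r := b⁻¹) hp₂ ht₂ ((le_max_right _ _).trans hbs)
    refine ⟨C₁ * C₂, ENNReal.mul_ne_top hC₁ hC₂, fun g₁ hg₁ g₂ hg₂ => ?_⟩
    calc _ ≤ L g₁ r₁ * L g₂ b⁻¹ :=
          young_ge (h₁.1 g₁ hg₁) (h₂.1 g₂ hg₂) z₃ (by linarith) (by positivity) i₃
            (by rw [inv_inv]; linarith) (by rw [inv_inv]; linarith)
      _ ≤ (C₁ * eLpNorm g₁ p₁ volume) * (C₂ * eLpNorm g₂ p₂ volume) :=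
          mul_le_mul' (b₁ g₁ hg₁) (b₂ g₂ hg₂)
      _ = _ := by ring

lemma eLpNorm_conv {n : ℕ} (u : EE n → ℂ) {α : ℝ} (hα : 0 < α) (p : ℝ≥0∞) :
    eLpNorm (fun x => ‖u x‖ ^ α) p volume = eLpNorm (fun x => ‖u x‖ₑ ^ α) p volume := by
  apply eLpNorm_congr_enorm_ae
  refine Filter.Eventually.of_forall fun x => ?_
  rw [Real.enorm_rpow_of_nonneg (norm_nonneg _) hα.le, enorm_norm, enorm_eq_self]

end YoungBL

/-- Young-type inequality below exponent one for band-limited-type functions.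
Let `φ₁, φ₂` be Schwartz functions, `α₁, α₂ > 0`, and `p₁, p₂, p₃ ∈ (0,∞]` with
`p₁, p₂ ≤ p₃` and `1/p₁' + 1/p₂' ≤ 1/p₃'` (where `r'` denotes the conjugate exponent of
`max 1 r`, so `1/r' = 1 − 1/max 1 r`).  Then there is `C > 0` such that
`‖ |u₁|^{α₁} * |u₂(−·)|^{α₂} ‖_{L^{p₃}} ≤ C ‖|u₁|^{α₁}‖_{L^{p₁}} ‖|u₂|^{α₂}‖_{L^{p₂}}`
for every `u₁ ∈ 𝒪(φ₁)` and `u₂ ∈ 𝒪(φ₂)` (tempered distributions with `uᵢ = uᵢ * φᵢ`,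
identified with continuous functions of polynomial growth via the reproducing identity). -/
theorem stmt_9 {n : ℕ} (φ₁ φ₂ : SchwartzMap (EuclideanSpace ℝ (Fin n)) ℂ)
    (α₁ α₂ : ℝ) (hα₁ : 0 < α₁) (hα₂ : 0 < α₂) (p₁ p₂ p₃ : ℝ≥0∞)
    (hp₁ : 0 < p₁) (hp₂ : 0 < p₂) (h₁₃ : p₁ ≤ p₃) (h₂₃ : p₂ ≤ p₃)
    (hconj : (1 - (max 1 p₁)⁻¹) + (1 - (max 1 p₂)⁻¹) ≤ 1 - (max 1 p₃)⁻¹) :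
    ∃ C : ℝ≥0∞, 0 < C ∧ C < ∞ ∧
      ∀ u₁ u₂ : EuclideanSpace ℝ (Fin n) → ℂ,
        Continuous u₁ → Continuous u₂ →
        (∃ (A : ℝ) (k : ℕ), ∀ x, ‖u₁ x‖ ≤ A * (1 + ‖x‖) ^ k) →
        (∃ (A : ℝ) (k : ℕ), ∀ x, ‖u₂ x‖ ≤ A * (1 + ‖x‖) ^ k) →
        (∀ x, u₁ x = ∫ y, u₁ y * φ₁ (x - y)) →
        (∀ x, u₂ x = ∫ y, u₂ y * φ₂ (x - y)) →
        (if p₃ = ∞ then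
            essSup (fun x => ∫⁻ y, (‖u₁ y‖₊ : ℝ≥0∞) ^ α₁ * (‖u₂ (y - x)‖₊ : ℝ≥0∞) ^ α₂) volume
          else
            (∫⁻ x, (∫⁻ y, (‖u₁ y‖₊ : ℝ≥0∞) ^ α₁ * (‖u₂ (y - x)‖₊ : ℝ≥0∞) ^ α₂) ^ p₃.toReal) ^
              (1 / p₃.toReal))
          ≤ C * eLpNorm (fun x => ‖u₁ x‖ ^ α₁) p₁ volume *
              eLpNorm (fun x => ‖u₂ x‖ ^ α₂) p₂ volume := by
  have h := YoungBL.conj_real hconj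
  have G₁ := YoungBL.good_rep φ₁ hα₁
  have G₂ := YoungBL.good_rep φ₂ hα₂
  by_cases hp₃ : p₃ = ∞
  · simp only [if_pos hp₃]
    obtain ⟨C, hC, b⟩ := YoungBL.young_top (p₃ := p₃) G₁ G₂ hp₁ hp₂ h
    refine ⟨C + 1, by simp, by simp [hC.lt_top], fun u₁ u₂ c₁ c₂ k₁ k₂ r₁ r₂ => ?_⟩
    rw [YoungBL.eLpNorm_conv u₁ hα₁, YoungBL.eLpNorm_conv u₂ hα₂]
    refine essSup_le_of_ae_le _ (Filter.Eventually.of_forall fun x => ?_)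
    refine (b _ ⟨_, YoungBL.rep_of φ₁ u₁ c₁ k₁ r₁, rfl⟩ _
      ⟨_, YoungBL.rep_of φ₂ u₂ c₂ k₂ r₂, rfl⟩ x).trans ?_
    exact mul_le_mul' (mul_le_mul' le_self_add le_rfl) le_rfl
  · simp only [if_neg hp₃, one_div]
    obtain ⟨C, hC, b⟩ := YoungBL.young_fin (p₃ := p₃) G₁ G₂ hp₁ hp₂ h₁₃ h₂₃ hp₃ h
    refine ⟨C + 1, by simp, by simp [hC.lt_top], fun u₁ u₂ c₁ c₂ k₁ k₂ r₁ r₂ => ?_⟩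
    rw [YoungBL.eLpNorm_conv u₁ hα₁, YoungBL.eLpNorm_conv u₂ hα₂]
    refine (b _ ⟨_, YoungBL.rep_of φ₁ u₁ c₁ k₁ r₁, rfl⟩ _
      ⟨_, YoungBL.rep_of φ₂ u₂ c₂ k₂ r₂, rfl⟩).trans ?_
    exact mul_le_mul' (mul_le_mul' le_self_add le_rfl) le_rfl
end

section
/- Let ℓ ∈ (0,∞) and θ ∈ (0,1). There exist probability measures μ₀, μ₁ on ℝ such that for every bounded uniformly continuous function f on the closed strip cl(S) = {z : 0 ≤ Re z ≤ 1} that is holomorphic on the open strip S, one has |f(θ)|^ℓ ≤ ( ∫_ℝ |f(it)|^ℓ dμ₀(t) )^{1−θ} · ( ∫_ℝ |f(1+it)|^ℓ dμ₁(t) )^{θ}. -/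
open MeasureTheory

/-- The closed unit strip `{z : 0 ≤ Re z ≤ 1}`. -/
def cStrip : Set ℂ := {z | 0 ≤ z.re ∧ z.re ≤ 1}

/-- The open unit strip `{z : 0 < Re z < 1}`. -/
def oStrip : Set ℂ := {z | 0 < z.re ∧ z.re < 1}

open Filter Topology Metric Set Real

lemma bdd_log_add {M ε x : ℝ} (hε : 0 < ε) (hx : 0 ≤ x) (hM : x ≤ M) :
    ‖Real.log (x + ε)‖ ≤ |Real.log ε| + |Real.log (M + ε)| := by
  have h1 : Real.log ε ≤ Real.log (x + ε) := Real.log_le_log hε (by linarith)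
  have h2 : Real.log (x + ε) ≤ Real.log (M + ε) := Real.log_le_log (by linarith) (by linarith)
  rw [Real.norm_eq_abs, abs_le]
  have := neg_abs_le (Real.log ε)
  have := le_abs_self (Real.log (M + ε))
  have := abs_nonneg (Real.log ε)
  have := abs_nonneg (Real.log (M + ε))
  constructor <;> linarith

lemma jensen_disc {g : ℂ → ℂ} {r ℓ ε : ℝ} (hr : 0 < r) (hℓ : 0 < ℓ) (hε : 0 < ε)
    (hg : AnalyticOnNhd ℂ g (closedBall 0 r)) (h0 : g 0 ≠ 0) :
    ℓ * Real.log ‖g 0‖ ≤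
      (2 * π)⁻¹ * ∫ s in (0 : ℝ)..2 * π, Real.log (‖g (circleMap 0 r s)‖ ^ ℓ + ε) := by
  have habs : |r| = r := abs_of_pos hr
  have hg' : AnalyticOnNhd ℂ g (closedBall 0 |r|) := by rwa [habs]
  have hJ := hg'.circleAverage_log_norm hr.ne' h0
  have h1 : Real.log ‖g 0‖ ≤ circleAverage (fun z => Real.log ‖g z‖) 0 r := by
    rw [hJ]
    have : 0 ≤ ∑ᶠ u, (MeromorphicOn.divisor g (closedBall 0 |r|) u : ℝ) *
        Real.log (r * ‖(0 : ℂ) - u‖⁻¹) := by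
      apply finsum_nonneg
      intro u
      by_cases hu : u ∈ closedBall (0 : ℂ) |r|
      · apply mul_nonneg
        · exact_mod_cast MeromorphicOn.AnalyticOnNhd.divisor_nonneg hg' u
        · by_cases hu0 : u = 0
          · simp [hu0]
          · apply Real.log_nonneg
            have : 0 < ‖u‖ := norm_pos_iff.2 hu0
            rw [mem_closedBall_zero_iff, habs] at hu
            rw [zero_sub, norm_neg, ← div_eq_mul_inv, le_div_iff₀ this]
            linarith
      · simp [hu]
    linarith
  let F : ℂ → ℝ := fun z => if g z = 0 then (Real.log ε) / ℓ else Real.log ‖g z‖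
  have hne : ∀ᶠ z in codiscreteWithin (sphere (0 : ℂ) |r|), g z ≠ 0 := by
    have := hg.preimage_zero_mem_codiscreteWithin h0 (by simp [hr.le])
      ((convex_closedBall (0 : ℂ) r).isConnected (by simp [hr.le]))
    rw [habs]
    exact codiscreteWithin_mono sphere_subset_closedBall this
  have hFe : (fun z => Real.log ‖g z‖) =ᶠ[codiscreteWithin (sphere (0 : ℂ) |r|)] F := by
    filter_upwards [hne] with z hz
    simp [F, hz]
  rw [circleAverage_congr_codiscreteWithin hFe hr.ne'] at h1
  have hint : CircleIntegrable (fun z => Real.log ‖g z‖) 0 r :=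
    MeromorphicOn.circleIntegrable_log_norm
      (fun z hz => (hg' z (sphere_subset_closedBall hz)).meromorphicAt)
  have hintF : CircleIntegrable F 0 r := hint.congr_codiscreteWithin hFe
  have hgc : Continuous (fun s => g (circleMap 0 r s)) :=
    (hg.continuousOn).comp_continuous (continuous_circleMap 0 r)
      (fun s => circleMap_mem_closedBall 0 hr.le s)
  have hpos : ∀ s, 0 < ‖g (circleMap 0 r s)‖ ^ ℓ + ε := fun s => by positivity
  have hc : Continuous (fun s => Real.log (‖g (circleMap 0 r s)‖ ^ ℓ + ε)) :=
    ((hgc.norm.rpow_const (fun _ => Or.inr hℓ.le)).add continuous_const).log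
      (fun s => (hpos s).ne')
  have h2 : ∫ s in (0 : ℝ)..2 * π, ℓ * F (circleMap 0 r s) ≤
      ∫ s in (0 : ℝ)..2 * π, Real.log (‖g (circleMap 0 r s)‖ ^ ℓ + ε) := by
    apply intervalIntegral.integral_mono_on (by positivity)
    · exact hintF.const_mul ℓ
    · exact hc.intervalIntegrable _ _
    · intro s _
      simp only [F]
      split_ifs with h
      · rw [h, norm_zero, Real.zero_rpow hℓ.ne', zero_add]
        field_simp
        exact le_rfl
      · have : 0 < ‖g (circleMap 0 r s)‖ := norm_pos_iff.2 h
        rw [← Real.log_rpow this]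
        exact Real.log_le_log (by positivity) (by linarith)
  rw [circleAverage_def, smul_eq_mul] at h1
  rw [intervalIntegral.integral_const_mul] at h2
  have h3 := mul_le_mul_of_nonneg_left h1 hℓ.le
  have h4 := mul_le_mul_of_nonneg_left h2 (show 0 ≤ (2 * π)⁻¹ by positivity)
  linarith [h3, h4, mul_left_comm ℓ (2 * π)⁻¹ (∫ s in (0 : ℝ)..2 * π, F (circleMap 0 r s))]

/-- Moebius map from disc to half plane. -/
noncomputable def moeb (θ : ℝ) (w : ℂ) : ℂ :=
  (Complex.exp (π * θ * Complex.I) - Complex.exp (-(π * θ * Complex.I)) * w) / (1 - w)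

/-- conformal map from disc to strip. -/
noncomputable def cmap (θ : ℝ) (w : ℂ) : ℂ := Complex.log (moeb θ w) * (-Complex.I / π)

/-- boundary values of `moeb`. -/
noncomputable def bz (θ s : ℝ) : ℝ := Real.sin (s / 2 - π * θ) / Real.sin (s / 2)

lemma exp_re_im (x : ℝ) : Complex.exp (x * Complex.I) = Real.cos x + Real.sin x * Complex.I := by
  rw [Complex.exp_mul_I]; push_cast; rfl

lemma moeb_im_pos {θ : ℝ} (h0 : 0 < θ) (h1 : θ < 1) {w : ℂ} (hw : ‖w‖ < 1) :
    0 < (moeb θ w).im := by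
  have hy : 0 < Real.sin (π * θ) :=
    Real.sin_pos_of_pos_of_lt_pi (by positivity) (by nlinarith [Real.pi_pos])
  have e1 : Complex.exp (π * θ * Complex.I) = Real.cos (π * θ) + Real.sin (π * θ) * Complex.I := by
    rw [← exp_re_im]; push_cast; rfl
  have e2 : Complex.exp (-(π * θ * Complex.I)) =
      Real.cos (π * θ) - Real.sin (π * θ) * Complex.I := by
    have := exp_re_im (-(π * θ))
    rw [Real.cos_neg, Real.sin_neg] at this
    push_cast at this ⊢
    rw [← neg_mul, this]; ring
  have hw2 : w.re * w.re + w.im * w.im < 1 := by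
    rw [← Complex.normSq_apply, Complex.normSq_eq_norm_sq]
    nlinarith [norm_nonneg w]
  have hne : 1 - w ≠ 0 := by
    intro h
    rw [← sub_eq_zero.1 h] at hw
    simp at hw
  have hns := Complex.normSq_pos.2 hne
  rw [moeb, e1, e2, Complex.div_im, ← sub_div]
  apply div_pos _ hns
  clear e1 e2
  generalize Real.sin (π * θ) = B at *
  generalize Real.cos (π * θ) = A at *
  simp
  nlinarith [mul_pos hy (sub_pos.2 hw2)]

lemma moeb_bdry {θ s : ℝ} (hs : Real.sin (s / 2) ≠ 0) :
    moeb θ (circleMap 0 1 s) = (bz θ s : ℂ) ∧ (1 : ℂ) - circleMap 0 1 s ≠ 0 := by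
  have e1 : Complex.exp (π * θ * Complex.I) = Real.cos (π * θ) + Real.sin (π * θ) * Complex.I := by
    rw [← exp_re_im]; push_cast; rfl
  have e2 : Complex.exp (-(π * θ * Complex.I)) =
      Real.cos (π * θ) - Real.sin (π * θ) * Complex.I := by
    have := exp_re_im (-(π * θ))
    rw [Real.cos_neg, Real.sin_neg] at this
    push_cast at this ⊢
    rw [← neg_mul, this]; ring
  have e3 : circleMap 0 1 s = (Real.cos (s / 2) + Real.sin (s / 2) * Complex.I) ^ 2 := by
    rw [← exp_re_im, ← Complex.exp_nat_mul, circleMap]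
    push_cast
    rw [zero_add, one_mul]; congr 1; ring
  have hI := Complex.I_sq
  have hcd : (Real.cos (s / 2) : ℂ) ^ 2 + (Real.sin (s / 2) : ℂ) ^ 2 = 1 := by
    exact_mod_cast Real.cos_sq_add_sin_sq (s / 2)
  have hbz : bz θ s = (Real.sin (s / 2) * Real.cos (π * θ) - Real.cos (s / 2) * Real.sin (π * θ))
      / Real.sin (s / 2) := by rw [bz, Real.sin_sub]
  have hne : (1 : ℂ) - circleMap 0 1 s ≠ 0 := by
    have : (1 : ℂ) - circleMap 0 1 s = (-2 * Complex.I * Real.sin (s / 2)) *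
        Complex.exp ((s / 2 : ℝ) * Complex.I) := by
      rw [e3, exp_re_im]
      linear_combination (-(Real.sin (s / 2) : ℂ) ^ 2 * (-1)) * hI - hcd
    rw [this]
    have : (Real.sin (s / 2) : ℂ) ≠ 0 := by exact_mod_cast hs
    exact mul_ne_zero (mul_ne_zero (by simp) this) (Complex.exp_ne_zero _)
  refine ⟨?_, hne⟩
  have hs' : (Real.sin (s / 2) : ℂ) ≠ 0 := by exact_mod_cast hs
  rw [moeb, hbz, div_eq_iff hne, e1, e2, e3]
  push_cast only [Complex.ofReal_div, Complex.ofReal_sub, Complex.ofReal_mul]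
  generalize (Real.sin (s / 2) : ℂ) = d at *
  generalize (Real.cos (s / 2) : ℂ) = c at *
  generalize (Real.sin (π * θ) : ℂ) = B at *
  generalize (Real.cos (π * θ) : ℂ) = A at *
  field_simp
  linear_combination (-B * (c + d * Complex.I)) * hcd + (B * (c + d * Complex.I) * d ^ 2) * hI

/-- boundary parametrization. -/
noncomputable def tau (θ s : ℝ) : ℝ := -Real.log (bz θ s) / π

lemma cmap_mem {θ : ℝ} (h0 : 0 < θ) (h1 : θ < 1) {w : ℂ} (hw : ‖w‖ < 1) :
    cmap θ w ∈ oStrip := by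
  have him := moeb_im_pos h0 h1 hw
  have hre : (cmap θ w).re = (moeb θ w).arg / π := by
    rw [cmap, Complex.mul_re, Complex.log_im]
    have e1 : (-Complex.I / (π : ℂ)).re = 0 := by simp
    have e2 : (-Complex.I / (π : ℂ)).im = -1 / π := by simp
    rw [e1, e2]; ring
  have hp : 0 < (moeb θ w).arg := by
    rcases (Complex.arg_nonneg_iff.2 him.le).lt_or_eq with h | h
    · exact h
    · have := (Complex.arg_eq_zero_iff.1 h.symm).2
      linarith
  have hlt : (moeb θ w).arg < π := Complex.arg_lt_pi_iff.2 (Or.inr him.ne')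
  refine ⟨?_, ?_⟩
  · rw [hre]; positivity
  · rw [hre, div_lt_one Real.pi_pos]; exact hlt

lemma cmap_zero {θ : ℝ} (h0 : 0 < θ) (h1 : θ < 1) : cmap θ 0 = θ := by
  have hpi := Real.pi_pos
  have : (π * θ * Complex.I : ℂ).im = π * θ := by simp
  rw [cmap, moeb, mul_zero, sub_zero, sub_zero, div_one, Complex.log_exp]
  · have : (π : ℂ) ≠ 0 := by exact_mod_cast hpi.ne'
    field_simp
    linear_combination (-(θ : ℂ)) * Complex.I_sq
  · rw [this]; nlinarith
  · rw [this]; nlinarith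

lemma moeb_diff {θ : ℝ} {w : ℂ} (hw : 1 - w ≠ 0) : DifferentiableAt ℂ (moeb θ) w := by
  unfold moeb
  fun_prop (disch := assumption)

lemma cmap_diff {θ : ℝ} (h0 : 0 < θ) (h1 : θ < 1) {w : ℂ} (hw : ‖w‖ < 1) :
    DifferentiableAt ℂ (cmap θ) w := by
  have hne : 1 - w ≠ 0 := by
    intro h
    rw [← sub_eq_zero.1 h] at hw
    simp at hw
  exact ((moeb_diff hne).clog (Or.inr (moeb_im_pos h0 h1 hw).ne')).mul_const _

lemma cmap_tendsto {θ : ℝ} (h0 : 0 < θ) (h1 : θ < 1) {s : ℝ} (hs : Real.sin (s / 2) ≠ 0)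
    (hb : bz θ s ≠ 0) :
    Tendsto (fun r : ℝ => cmap θ (circleMap 0 r s)) (𝓝[<] 1)
      (𝓝[cStrip] (if 0 < bz θ s then Complex.I * (tau θ s : ℂ)
        else 1 + Complex.I * (tau θ s : ℂ))) := by
  obtain ⟨hm, hne⟩ := moeb_bdry (θ := θ) hs
  have hr01 : ∀ᶠ r : ℝ in 𝓝[<] 1, ‖circleMap 0 r s‖ < 1 := by
    have : Ioo (0 : ℝ) 1 ∈ 𝓝[<] (1 : ℝ) := Ioo_mem_nhdsLT (by norm_num)
    filter_upwards [this] with r hr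
    rw [norm_circleMap_zero, abs_of_pos hr.1]
    exact hr.2
  have hcm : Tendsto (fun r : ℝ => circleMap 0 r s) (𝓝[<] 1) (𝓝 (circleMap 0 1 s)) := by
    have : Continuous (fun r : ℝ => circleMap 0 r s) := by
      unfold circleMap; fun_prop
    exact (this.tendsto 1).mono_left nhdsWithin_le_nhds
  have hmo : Tendsto (fun r : ℝ => moeb θ (circleMap 0 r s)) (𝓝[<] 1)
      (𝓝[{z : ℂ | 0 ≤ z.im}] (bz θ s : ℂ)) := by
    rw [tendsto_nhdsWithin_iff]
    refine ⟨?_, ?_⟩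
    · rw [← hm]
      exact (moeb_diff hne).continuousAt.tendsto.comp hcm
    · filter_upwards [hr01] with r hr
      exact (moeb_im_pos h0 h1 hr).le
  have hlog : ContinuousWithinAt Complex.log {z : ℂ | 0 ≤ z.im} (bz θ s : ℂ) := by
    rcases lt_or_gt_of_ne hb with h | h
    · exact Complex.continuousWithinAt_log_of_re_neg_of_im_zero (by simpa using h) (by simp)
    · exact (continuousAt_clog (Or.inl (by simpa using h))).continuousWithinAt
  rw [tendsto_nhdsWithin_iff]
  refine ⟨?_, ?_⟩
  · have hpi : (π : ℂ) ≠ 0 := by exact_mod_cast Real.pi_pos.ne'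
    have hval : (if 0 < bz θ s then Complex.I * (tau θ s : ℂ)
        else 1 + Complex.I * (tau θ s : ℂ)) = Complex.log (bz θ s : ℂ) * (-Complex.I / π) := by
      split_ifs with h
      · rw [← Complex.ofReal_log h.le, tau]
        push_cast
        ring
      · have h' : bz θ s < 0 := lt_of_le_of_ne (not_lt.1 h) hb
        have : Complex.log (bz θ s : ℂ) = (Real.log (bz θ s) : ℂ) + π * Complex.I := by
          apply Complex.ext
          · simp [Complex.log_re]
          · simp [Complex.log_im, Complex.arg_ofReal_of_neg h']
        rw [this, tau]
        push_cast
        field_simp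
        linear_combination (π : ℂ) * Complex.I_sq
    rw [hval]
    exact (hlog.tendsto.comp hmo).mul_const _
  · filter_upwards [hr01] with r hr
    have := cmap_mem h0 h1 hr
    exact ⟨this.1.le, this.2.le⟩

/-- normalized Lebesgue measure on an interval. -/
noncomputable def arcMeas (a b : ℝ) : Measure ℝ :=
  (ENNReal.ofReal (b - a))⁻¹ • volume.restrict (Ioc a b)

lemma arcMeas_prob {a b : ℝ} (hab : a < b) : IsProbabilityMeasure (arcMeas a b) := by
  constructor
  have h : 0 < b - a := by linarith
  rw [arcMeas, Measure.smul_apply, Measure.restrict_apply_univ, Real.volume_Ioc, smul_eq_mul]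
  exact ENNReal.inv_mul_cancel (by simpa using hab) ENNReal.ofReal_ne_top

lemma arcMeas_integral {a b : ℝ} (hab : a < b) (h : ℝ → ℝ) :
    (b - a) * ∫ s, h s ∂(arcMeas a b) = ∫ s in a..b, h s := by
  have h' : 0 < b - a := by linarith
  rw [arcMeas, integral_smul_measure, intervalIntegral.integral_of_le hab.le, smul_eq_mul,
    ENNReal.toReal_inv, ENNReal.toReal_ofReal h'.le, ← mul_assoc, mul_inv_cancel₀ h'.ne', one_mul]

lemma arc_jensen {a b M ε : ℝ} (hab : a < b) (hε : 0 < ε) {h : ℝ → ℝ} (hm : Measurable h)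
    (h0 : ∀ s, 0 ≤ h s) (hM : ∀ s, h s ≤ M) :
    ∫ s in a..b, Real.log (h s + ε) ≤ (b - a) * Real.log (∫ s, h s ∂(arcMeas a b) + ε) := by
  have := arcMeas_prob hab
  rw [← arcMeas_integral hab]
  apply mul_le_mul_of_nonneg_left _ (by linarith)
  have hi : Integrable h (arcMeas a b) :=
    Integrable.of_bound hm.aestronglyMeasurable M
      (ae_of_all _ fun s => by rw [Real.norm_eq_abs, abs_of_nonneg (h0 s)]; exact hM s)
  have hi2 : Integrable (Real.log ∘ fun s => h s + ε) (arcMeas a b) :=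
    Integrable.of_bound (Real.measurable_log.comp (hm.add_const ε)).aestronglyMeasurable
      (|Real.log ε| + |Real.log (M + ε)|) (ae_of_all _ fun s => bdd_log_add hε (h0 s) (hM s))
  have hsub : Ici ε ⊆ Ioi (0 : ℝ) := fun x hx => lt_of_lt_of_le hε hx
  have := ConcaveOn.le_map_integral (μ := arcMeas a b) (f := fun s => h s + ε)
    (strictConcaveOn_log_Ioi.concaveOn.subset hsub (convex_Ici ε))
    (Real.continuousOn_log.mono fun x hx => (hsub hx).ne') isClosed_Ici
    (ae_of_all _ fun s => by simpa using h0 s) (hi.add (integrable_const ε)) hi2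
  rw [integral_add hi (integrable_const ε)] at this
  simpa using this

lemma arc_limit {f : ℂ → ℂ} {M ℓ ε θ a b : ℝ} (hℓ : 0 < ℓ) (hε : 0 < ε) (hθ₀ : 0 < θ) (hθ₁ : θ < 1)
    (hM : ∀ z ∈ cStrip, ‖f z‖ ≤ M) (hc : ContinuousOn f cStrip) (hd : DifferentiableOn ℂ f oStrip)
    (hab : a ≤ b) (H : ℝ → ℂ) (hH : ∀ s, H s ∈ cStrip)
    (hlim : ∀ s ∈ Ioo a b, Tendsto (fun r : ℝ => cmap θ (circleMap 0 r s)) (𝓝[<] 1)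
      (𝓝[cStrip] (H s))) :
    Tendsto (fun r : ℝ => ∫ s in a..b, Real.log (‖f (cmap θ (circleMap 0 r s))‖ ^ ℓ + ε))
      (𝓝[<] 1) (𝓝 (∫ s in a..b, Real.log (‖f (H s)‖ ^ ℓ + ε))) := by
  have hI : Ioo (0 : ℝ) 1 ∈ 𝓝[<] (1 : ℝ) := Ioo_mem_nhdsLT (by norm_num)
  have hlt : ∀ r ∈ Ioo (0 : ℝ) 1, ∀ s, ‖circleMap 0 r s‖ < 1 := fun r hr s => by
    rw [norm_circleMap_zero, abs_of_pos hr.1]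
    exact hr.2
  have hoc : oStrip ⊆ cStrip := fun z hz => ⟨hz.1.le, hz.2.le⟩
  apply intervalIntegral.tendsto_integral_filter_of_dominated_convergence
    (fun _ => |Real.log ε| + |Real.log (M ^ ℓ + ε)|)
  · filter_upwards [hI] with r hr
    have : Continuous (fun s => f (cmap θ (circleMap 0 r s))) := by
      apply hc.comp_continuous
      · rw [continuous_iff_continuousAt]
        intro s
        exact (cmap_diff hθ₀ hθ₁ (hlt r hr s)).continuousAt.comp
          (continuous_circleMap 0 r).continuousAt
      · exact fun s => hoc (cmap_mem hθ₀ hθ₁ (hlt r hr s))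
    exact (((this.norm.rpow_const (fun _ => Or.inr hℓ.le)).add continuous_const).log
      (fun s => (add_pos_of_nonneg_of_pos (Real.rpow_nonneg (norm_nonneg _) _) hε).ne')).aestronglyMeasurable
  · filter_upwards [hI] with r hr
    refine ae_of_all _ fun s _ => bdd_log_add hε (by positivity) ?_
    exact Real.rpow_le_rpow (norm_nonneg _) (hM _ (hoc (cmap_mem hθ₀ hθ₁ (hlt r hr s)))) hℓ.le
  · exact intervalIntegrable_const
  · have hb : ∀ᵐ s : ℝ, s ≠ b := by simp [ae_iff]
    filter_upwards [hb] with s hsb hs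
    rw [uIoc_of_le hab] at hs
    have h1 := (hc (H s) (hH s)).tendsto.comp
      (hlim s ⟨hs.1, lt_of_le_of_ne hs.2 hsb⟩)
    have h2 : Tendsto (fun r : ℝ => ‖f (cmap θ (circleMap 0 r s))‖ ^ ℓ + ε) (𝓝[<] 1)
        (𝓝 (‖f (H s)‖ ^ ℓ + ε)) :=
      (h1.norm.rpow_const (Or.inr hℓ.le)).add_const ε
    exact h2.log (by positivity)

lemma tau_measurable (θ : ℝ) : Measurable (tau θ) := by
  unfold tau bz
  fun_prop

lemma memI (t : ℝ) : Complex.I * (t : ℂ) ∈ cStrip := by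
  simp [cStrip]

lemma memI1 (t : ℝ) : 1 + Complex.I * (t : ℂ) ∈ cStrip := by
  simp [cStrip]

lemma log_bound {f : ℂ → ℂ} {M ℓ ε θ : ℝ} (hℓ : 0 < ℓ) (hε : 0 < ε) (hθ₀ : 0 < θ) (hθ₁ : θ < 1)
    (hM : ∀ z ∈ cStrip, ‖f z‖ ≤ M) (hc : ContinuousOn f cStrip) (hd : DifferentiableOn ℂ f oStrip)
    (hf : f θ ≠ 0) :
    ℓ * Real.log ‖f θ‖ ≤ (2 * π)⁻¹ *
      ((∫ s in (0 : ℝ)..2 * π * θ, Real.log (‖f (1 + Complex.I * (tau θ s : ℂ))‖ ^ ℓ + ε)) +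
      ∫ s in (2 * π * θ)..2 * π, Real.log (‖f (Complex.I * (tau θ s : ℂ))‖ ^ ℓ + ε)) := by
  have hpi := Real.pi_pos
  have hI : Ioo (0 : ℝ) 1 ∈ 𝓝[<] (1 : ℝ) := Ioo_mem_nhdsLT (by norm_num)
  have hoc : oStrip ⊆ cStrip := fun z hz => ⟨hz.1.le, hz.2.le⟩
  have hopen : IsOpen oStrip :=
    (isOpen_lt continuous_const Complex.continuous_re).inter
      (isOpen_lt Complex.continuous_re continuous_const)
  have l1 := arc_limit hℓ hε hθ₀ hθ₁ hM hc hd (a := 0) (b := 2 * π * θ) (by positivity)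
    (fun s => 1 + Complex.I * (tau θ s : ℂ)) (fun s => memI1 _) (by
      intro s hs
      have h1 : 0 < Real.sin (s / 2) :=
        Real.sin_pos_of_pos_of_lt_pi (by linarith [hs.1]) (by nlinarith [hs.2])
      have h2 : Real.sin (s / 2 - π * θ) < 0 :=
        Real.sin_neg_of_neg_of_neg_pi_lt (by linarith [hs.2]) (by nlinarith [hs.1])
      have hb : bz θ s < 0 := div_neg_of_neg_of_pos h2 h1
      have := cmap_tendsto hθ₀ hθ₁ h1.ne' hb.ne
      rwa [if_neg hb.not_gt] at this)
  have l2 := arc_limit hℓ hε hθ₀ hθ₁ hM hc hd (a := 2 * π * θ) (b := 2 * π) (by nlinarith)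
    (fun s => Complex.I * (tau θ s : ℂ)) (fun s => memI _) (by
      intro s hs
      have hp : 0 < π * θ := by positivity
      have h1 : 0 < Real.sin (s / 2) :=
        Real.sin_pos_of_pos_of_lt_pi (by linarith [hs.1]) (by linarith [hs.2])
      have h2 : 0 < Real.sin (s / 2 - π * θ) :=
        Real.sin_pos_of_pos_of_lt_pi (by linarith [hs.1]) (by linarith [hs.2])
      have hb : 0 < bz θ s := div_pos h2 h1
      have := cmap_tendsto hθ₀ hθ₁ h1.ne' hb.ne'
      rwa [if_pos hb] at this)
  refine ge_of_tendsto ((l1.add l2).const_mul (2 * π)⁻¹) ?_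
  filter_upwards [hI] with r hr
  have hlt : ∀ w ∈ closedBall (0 : ℂ) r, ‖w‖ < 1 := fun w hw =>
    lt_of_le_of_lt (mem_closedBall_zero_iff.1 hw) hr.2
  have hdiff : DifferentiableOn ℂ (fun w => f (cmap θ w)) (ball 0 1) := by
    intro w hw
    have hw' : ‖w‖ < 1 := mem_ball_zero_iff.1 hw
    exact ((hd.differentiableAt (hopen.mem_nhds (cmap_mem hθ₀ hθ₁ hw'))).comp w
      (cmap_diff hθ₀ hθ₁ hw')).differentiableWithinAt
  have hg : AnalyticOnNhd ℂ (fun w => f (cmap θ w)) (closedBall 0 r) :=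
    (hdiff.analyticOnNhd isOpen_ball).mono (fun w hw => mem_ball_zero_iff.2 (hlt w hw))
  have hj := jensen_disc hr.1 hℓ hε hg (by simpa [cmap_zero hθ₀ hθ₁] using hf)
  have hcont : Continuous (fun s => f (cmap θ (circleMap 0 r s))) :=
    (hg.continuousOn).comp_continuous (continuous_circleMap 0 r)
      (fun s => circleMap_mem_closedBall 0 hr.1.le s)
  have hcl : Continuous (fun s => Real.log (‖f (cmap θ (circleMap 0 r s))‖ ^ ℓ + ε)) :=
    ((hcont.norm.rpow_const (fun _ => Or.inr hℓ.le)).add continuous_const).log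
      (fun s => (add_pos_of_nonneg_of_pos (Real.rpow_nonneg (norm_nonneg _) _) hε).ne')
  rw [cmap_zero hθ₀ hθ₁] at hj
  rwa [intervalIntegral.integral_add_adjacent_intervals (hcl.intervalIntegrable _ _)
    (hcl.intervalIntegrable _ _)]

/-- Harmonic-majorization estimate on the strip.  For every `ℓ ∈ (0,∞)` and `θ ∈ (0,1)`
there are probability measures `μ₀, μ₁` on `ℝ` such that
`|f(θ)|^ℓ ≤ (∫ |f(it)|^ℓ dμ₀)^{1−θ} · (∫ |f(1+it)|^ℓ dμ₁)^θ`
for every bounded uniformly continuous `f` on the closed strip which is holomorphic on the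
open strip. -/
theorem stmt_15 (ℓ θ : ℝ) (hℓ : 0 < ℓ) (hθ₀ : 0 < θ) (hθ₁ : θ < 1) :
    ∃ μ₀ μ₁ : Measure ℝ, IsProbabilityMeasure μ₀ ∧ IsProbabilityMeasure μ₁ ∧
      ∀ f : ℂ → ℂ, (∃ M, ∀ z ∈ cStrip, ‖f z‖ ≤ M) →
        UniformContinuousOn f cStrip → DifferentiableOn ℂ f oStrip →
        ‖f (θ : ℂ)‖ ^ ℓ ≤
          (∫ t, ‖f (Complex.I * (t : ℂ))‖ ^ ℓ ∂μ₀) ^ (1 - θ) *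
            (∫ t, ‖f (1 + Complex.I * (t : ℂ))‖ ^ ℓ ∂μ₁) ^ θ := by
  have hpi := Real.pi_pos
  have hab0 : 2 * π * θ < 2 * π := by nlinarith
  have hab1 : 0 < 2 * π * θ := by positivity
  have := arcMeas_prob hab0
  have := arcMeas_prob hab1
  have hτ := tau_measurable θ
  refine ⟨(arcMeas (2 * π * θ) (2 * π)).map (tau θ), (arcMeas 0 (2 * π * θ)).map (tau θ),
    Measure.isProbabilityMeasure_map hτ.aemeasurable,
    Measure.isProbabilityMeasure_map hτ.aemeasurable, ?_⟩
  rintro f ⟨M, hM⟩ huc hd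
  have hc := huc.continuousOn
  have hc0 : Continuous (fun t : ℝ => ‖f (Complex.I * (t : ℂ))‖ ^ ℓ) :=
    (hc.comp_continuous (by fun_prop) memI).norm.rpow_const (fun _ => Or.inr hℓ.le)
  have hc1 : Continuous (fun t : ℝ => ‖f (1 + Complex.I * (t : ℂ))‖ ^ ℓ) :=
    (hc.comp_continuous (by fun_prop) memI1).norm.rpow_const (fun _ => Or.inr hℓ.le)
  rw [integral_map hτ.aemeasurable hc0.aestronglyMeasurable,
    integral_map hτ.aemeasurable hc1.aestronglyMeasurable]
  set A := ∫ s, ‖f (Complex.I * (tau θ s : ℂ))‖ ^ ℓ ∂(arcMeas (2 * π * θ) (2 * π)) with hA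
  set B := ∫ s, ‖f (1 + Complex.I * (tau θ s : ℂ))‖ ^ ℓ ∂(arcMeas 0 (2 * π * θ)) with hB
  have hA0 : 0 ≤ A := integral_nonneg fun s => by positivity
  have hB0 : 0 ≤ B := integral_nonneg fun s => by positivity
  by_cases hf : f θ = 0
  · rw [hf, norm_zero, Real.zero_rpow hℓ.ne']
    positivity
  have key : ∀ ε : ℝ, 0 < ε → ‖f (θ : ℂ)‖ ^ ℓ ≤ (A + ε) ^ (1 - θ) * (B + ε) ^ θ := by
    intro ε hε
    have h := log_bound hℓ hε hθ₀ hθ₁ hM hc hd hf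
    have j0 := arc_jensen (M := M ^ ℓ) hab0 hε (hc0.measurable.comp hτ)
      (fun s => by simp only [Function.comp]; positivity)
      (fun s => Real.rpow_le_rpow (norm_nonneg _) (hM _ (memI _)) hℓ.le)
    have j1 := arc_jensen (M := M ^ ℓ) hab1 hε (hc1.measurable.comp hτ)
      (fun s => by simp only [Function.comp]; positivity)
      (fun s => Real.rpow_le_rpow (norm_nonneg _) (hM _ (memI1 _)) hℓ.le)
    simp only [Function.comp] at j0 j1
    rw [← hA] at j0
    rw [← hB] at j1
    have hAp : 0 < A + ε := by linarith
    have hBp : 0 < B + ε := by linarith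
    have hfp : 0 < ‖f (θ : ℂ)‖ := norm_pos_iff.2 hf
    have h5 : ℓ * Real.log ‖f (θ : ℂ)‖ ≤
        (1 - θ) * Real.log (A + ε) + θ * Real.log (B + ε) := by
      refine h.trans ?_
      refine (mul_le_mul_of_nonneg_left (add_le_add j1 j0) (by positivity)).trans (le_of_eq ?_)
      field_simp
      ring
    rw [← Real.log_le_log_iff (by positivity) (by positivity), Real.log_rpow hfp,
      Real.log_mul (by positivity) (by positivity), Real.log_rpow hAp, Real.log_rpow hBp]
    exact h5
  have hlimA : Tendsto (fun ε : ℝ => (A + ε) ^ (1 - θ) * (B + ε) ^ θ) (𝓝[>] 0)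
      (𝓝 (A ^ (1 - θ) * B ^ θ)) := by
    have hcn : Continuous (fun ε : ℝ => (A + ε) ^ (1 - θ) * (B + ε) ^ θ) :=
      ((continuous_const.add continuous_id).rpow_const (fun _ => Or.inr (by linarith))).mul
        ((continuous_const.add continuous_id).rpow_const (fun _ => Or.inr hθ₀.le))
    have := hcn.tendsto 0
    simp only [add_zero] at this
    exact this.mono_left nhdsWithin_le_nhds
  exact ge_of_tendsto hlimA (eventually_mem_nhdsWithin.mono fun ε hε => key ε hε)
end

section
/- Let 𝒮_∞(ℝ^n) = { φ ∈ 𝒮(ℝ^n) : ∫ φ(x) P(x) dx = 0 for every polynomial P }. Then 𝒮_∞(ℝ^n) equals the set of Schwartz functions all of whose moments vanish, equivalently the set of φ ∈ 𝒮(ℝ^n) such that the Fourier transform of φ vanishes of infinite order at 0; moreover, for every φ ∈ 𝒮_∞(ℝ^n) and every k ∈ ℕ there exists φ_k ∈ 𝒮(ℝ^n) with φ = Δ^k φ_k, where Δ is the Laplacian. -/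
open MeasureTheory
open scoped FourierTransform

/-- The Laplacian of a function on `ℝⁿ`, `Δf(x) = ∑ᵢ ∂²f/∂xᵢ²(x)`. -/
noncomputable def lap {n : ℕ} (f : EuclideanSpace ℝ (Fin n) → ℂ) :
    EuclideanSpace ℝ (Fin n) → ℂ :=
  fun x => ∑ i : Fin n,
    iteratedFDeriv ℝ 2 f x (fun _ => EuclideanSpace.single i (1 : ℝ))


section division

variable {E : Type} [NormedAddCommGroup E] [InnerProductSpace ℝ E]

/-- A function vanishing of infinite order at the origin. -/
def FlatAtZero {V : Type} [NormedAddCommGroup V] [NormedSpace ℝ V] (f : E → V) : Prop :=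
  ∀ m : ℕ, iteratedFDeriv ℝ m f 0 = 0

lemma FlatAtZero.bilin {V W X : Type} [NormedAddCommGroup V] [NormedSpace ℝ V]
    [NormedAddCommGroup W] [NormedSpace ℝ W] [NormedAddCommGroup X] [NormedSpace ℝ X]
    (B : V →L[ℝ] W →L[ℝ] X) {f : E → V} {g : E → W} (hf : ContDiff ℝ (⊤ : ℕ∞) f)
    (hg : ContDiff ℝ (⊤ : ℕ∞) g) (h : FlatAtZero f) :
    FlatAtZero (fun x => B (f x) (g x)) := by
  intro m
  have := B.norm_iteratedFDeriv_le_of_bilinear hf hg 0 (n := m) (by exact_mod_cast le_top)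
  have h0 : ∀ i, iteratedFDeriv ℝ i f 0 = 0 := h
  simp only [h0, norm_zero, mul_zero, zero_mul, Finset.sum_const_zero] at this
  simpa using this

lemma FlatAtZero.fderiv {V : Type} [NormedAddCommGroup V] [NormedSpace ℝ V] {f : E → V}
    (h : FlatAtZero f) : FlatAtZero (fderiv ℝ f) := by
  intro m
  have := norm_iteratedFDeriv_fderiv (𝕜 := ℝ) (f := f) (x := 0) (n := m)
  rw [h (m + 1), norm_zero] at this
  simpa using this

lemma FlatAtZero.zero {V : Type} [NormedAddCommGroup V] [NormedSpace ℝ V] {f : E → V}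
    (h : FlatAtZero f) : f 0 = 0 := by
  have := congrArg norm (h 0)
  simpa using this

lemma FlatAtZero.bound (N : ℕ) : ∀ {V : Type} [NormedAddCommGroup V] [NormedSpace ℝ V]
    (F : SchwartzMap E V) (_ : FlatAtZero F), ∃ C, 0 ≤ C ∧ ∀ x, ‖F x‖ ≤ C * ‖x‖ ^ N := by
  induction N with
  | zero =>
    intro V _ _ F h
    obtain ⟨C, hC⟩ := F.decay 0 0
    exact ⟨C, hC.1.le, fun x => by simpa using hC.2 x⟩
  | succ N ih =>
    intro V _ _ F h
    obtain ⟨C, hC0, hC⟩ := ih (SchwartzMap.fderivCLM ℝ E V F) h.fderiv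
    refine ⟨C, hC0, fun x => ?_⟩
    have := (convex_closedBall (0 : E) ‖x‖).norm_image_sub_le_of_norm_fderiv_le (𝕜 := ℝ)
      (f := F) (C := C * ‖x‖ ^ N) (x := 0) (y := x) (fun y _ => F.differentiableAt)
      (fun y hy => (hC y).trans (by
        have : ‖y‖ ≤ ‖x‖ := by simpa using hy
        gcongr)) (by simp) (by simp)
    rw [h.zero, sub_zero, sub_zero] at this
    rw [pow_succ, ← mul_assoc]
    exact this

/-- The numerator of the derivative of `|x|^{-2j} F`. -/
noncomputable def numer {V : Type} [NormedAddCommGroup V] [NormedSpace ℝ V] (j : ℕ)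
    (F : SchwartzMap E V) : SchwartzMap E (E →L[ℝ] V) :=
  SchwartzMap.bilinLeftCLM (ContinuousLinearMap.lsmul ℝ ℝ).flip
    (Function.hasTemperateGrowth_norm_sq (H := E)) (SchwartzMap.fderivCLM ℝ E V F) -
  (2 * j : ℝ) • SchwartzMap.bilinLeftCLM (ContinuousLinearMap.smulRightL ℝ E V).flip
    (innerSL ℝ (E := E)).hasTemperateGrowth F

lemma numer_apply {V : Type} [NormedAddCommGroup V] [NormedSpace ℝ V] (j : ℕ)
    (F : SchwartzMap E V) (x : E) : numer j F x =
      ‖x‖ ^ 2 • fderiv ℝ F x - (2 * j : ℝ) • (innerSL ℝ x).smulRight (F x) := rfl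

lemma numer_flat {V : Type} [NormedAddCommGroup V] [NormedSpace ℝ V] (j : ℕ)
    (F : SchwartzMap E V) (h : FlatAtZero F) : FlatAtZero (numer j F) := by
  have h1 : FlatAtZero (SchwartzMap.bilinLeftCLM (ContinuousLinearMap.lsmul ℝ ℝ).flip
    (Function.hasTemperateGrowth_norm_sq (H := E)) (SchwartzMap.fderivCLM ℝ E V F)) :=
    FlatAtZero.bilin (ContinuousLinearMap.lsmul ℝ ℝ).flip
      ((SchwartzMap.fderivCLM ℝ E V F).smooth ⊤)
      (Function.hasTemperateGrowth_norm_sq (H := E)).1 h.fderiv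
  have h2 : FlatAtZero (SchwartzMap.bilinLeftCLM (ContinuousLinearMap.smulRightL ℝ E V).flip
    (innerSL ℝ (E := E)).hasTemperateGrowth F) :=
    FlatAtZero.bilin (ContinuousLinearMap.smulRightL ℝ E V).flip
      (F.smooth ⊤) (innerSL ℝ (E := E)).hasTemperateGrowth.1 h
  intro m
  unfold numer
  rw [sub_eq_add_neg, ← neg_smul]
  have e : ∀ (a b : SchwartzMap E (E →L[ℝ] V)) (c : ℝ),
    ((a + c • b : SchwartzMap E (E →L[ℝ] V)) : E → E →L[ℝ] V) = ⇑a + c • ⇑b := fun _ _ _ => rfl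
  rw [e, iteratedFDeriv_add_apply, iteratedFDeriv_const_smul_apply, h1 m, h2 m]
  · simp
  · exact ContDiff.contDiffAt (SchwartzMap.smooth _ m)
  · exact ContDiff.contDiffAt (SchwartzMap.smooth _ m)
  · exact ContDiff.contDiffAt (SchwartzMap.smooth ((-(2 * j : ℝ)) •
      SchwartzMap.bilinLeftCLM (ContinuousLinearMap.smulRightL ℝ E V).flip
        (innerSL ℝ (E := E)).hasTemperateGrowth F) m)

/-- Division by `|x|^{2j}`. -/
noncomputable def divi {V : Type} [NormedAddCommGroup V] [NormedSpace ℝ V] (j : ℕ)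
    (F : E → V) : E → V := fun x => ((‖x‖ ^ 2)⁻¹) ^ j • F x

lemma divi_hasFDerivAt {V : Type} [NormedAddCommGroup V] [NormedSpace ℝ V] (j : ℕ)
    (F : SchwartzMap E V) (h : FlatAtZero F) (x : E) :
    HasFDerivAt (divi j F) (divi (j + 1) (numer j F) x) x := by
  by_cases hx : x = 0
  · subst hx
    have e0 : divi (j + 1) (numer j F) 0 = 0 := by simp [divi]
    rw [e0]
    obtain ⟨C, hC0, hC⟩ := FlatAtZero.bound (2 * j + 2) F h
    refine Asymptotics.IsBigO.hasFDerivAt (n := 2) ?_ (by norm_num)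
    refine Asymptotics.IsBigO.of_bound C (Filter.Eventually.of_forall fun y => ?_)
    by_cases hy : y = 0
    · subst hy
      simp [divi, h.zero]
    · have hy' : 0 < ‖y‖ := norm_pos_iff.2 hy
      rw [divi, norm_smul, norm_pow, norm_inv, norm_pow, norm_norm, sub_zero, norm_pow, norm_norm]
      calc _ ≤ ((‖y‖ ^ 2)⁻¹) ^ j * (C * ‖y‖ ^ (2 * j + 2)) := by gcongr; exact hC y
        _ = _ := by
          rw [pow_add, pow_mul, inv_pow]
          field_simp
  · have hx' : ‖x‖ ≠ 0 := norm_ne_zero_iff.2 hx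
    have hn : HasFDerivAt (fun y : E => ‖y‖ ^ 2) (2 • innerSL ℝ x) x :=
      (hasStrictFDerivAt_norm_sq x).hasFDerivAt
    have h1 := ((hasDerivAt_inv (pow_ne_zero 2 hx')).pow j).comp_hasFDerivAt x hn
    have h2 := h1.smul (F.hasFDerivAt x)
    refine h2.congr_fderiv ?_
    ext v
    simp only [divi, numer_apply]
    rcases j with _ | j
    · simp [smul_smul, hx']
    · simp [smul_smul, smul_sub]
      rw [sub_eq_add_neg]
      congr 1
      · congr 1; field_simp; ring
      · congr 2; field_simp; ring

lemma divi_contDiff (m : ℕ) : ∀ {V : Type} [NormedAddCommGroup V] [NormedSpace ℝ V] (j : ℕ)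
    (F : SchwartzMap E V) (_ : FlatAtZero F), ContDiff ℝ m (divi j F) := by
  induction m with
  | zero =>
    intro V _ _ j F h
    have : Differentiable ℝ (divi j F) := fun x => (divi_hasFDerivAt j F h x).differentiableAt
    simpa using (contDiff_zero (𝕜 := ℝ)).2 this.continuous
  | succ m ih =>
    intro V _ _ j F h
    have e : fderiv ℝ (divi j F) = divi (j + 1) (numer j F) :=
      funext fun x => (divi_hasFDerivAt j F h x).fderiv
    push_cast
    rw [contDiff_succ_iff_fderiv, e]
    exact ⟨fun x => (divi_hasFDerivAt j F h x).differentiableAt, by simp,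
      ih _ _ (numer_flat j F h)⟩

lemma divi_flat (m : ℕ) : ∀ {V : Type} [NormedAddCommGroup V] [NormedSpace ℝ V] (j : ℕ)
    (F : SchwartzMap E V) (_ : FlatAtZero F), iteratedFDeriv ℝ m (divi j F) 0 = 0 := by
  induction m with
  | zero =>
    intro V _ _ j F h
    rw [← norm_eq_zero]
    simp [divi, h.zero]
  | succ m ih =>
    intro V _ _ j F h
    have e : fderiv ℝ (divi j F) = divi (j + 1) (numer j F) :=
      funext fun x => (divi_hasFDerivAt j F h x).fderiv
    rw [← norm_eq_zero, ← norm_iteratedFDeriv_fderiv, e, ih _ _ (numer_flat j F h), norm_zero]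

lemma divi_decay (k m : ℕ) : ∀ {V : Type} [NormedAddCommGroup V] [NormedSpace ℝ V] (j : ℕ)
    (F : SchwartzMap E V) (_ : FlatAtZero F),
    ∃ C, ∀ x, ‖x‖ ^ k * ‖iteratedFDeriv ℝ m (divi j F) x‖ ≤ C := by
  induction m with
  | zero =>
    intro V _ _ j F h
    obtain ⟨C, hC0, hC⟩ := FlatAtZero.bound (2 * j) F h
    obtain ⟨D, hD⟩ := F.decay k 0
    refine ⟨max C D, fun x => ?_⟩
    rw [norm_iteratedFDeriv_zero, divi, norm_smul, norm_pow, norm_inv, norm_pow, norm_norm]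
    rcases le_total ‖x‖ 1 with h1 | h1
    · refine le_trans ?_ (le_max_left _ _)
      by_cases hx : x = 0
      · subst hx; simp [h.zero, hC0]
      have hx' : 0 < ‖x‖ := norm_pos_iff.2 hx
      calc _ ≤ 1 * (((‖x‖ ^ 2)⁻¹) ^ j * (C * ‖x‖ ^ (2 * j))) := by
            gcongr
            · exact pow_le_one₀ (norm_nonneg _) h1
            · exact hC x
        _ = C := by
          rw [pow_mul, inv_pow]
          field_simp
    · refine le_trans ?_ (le_max_right _ _)
      have := hD.2 x
      rw [norm_iteratedFDeriv_zero] at this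
      refine le_trans ?_ this
      gcongr
      have : (‖x‖ ^ 2)⁻¹ ^ j ≤ 1 :=
        pow_le_one₀ (by positivity) (inv_le_one_of_one_le₀ (one_le_pow₀ h1))
      nlinarith [norm_nonneg (F x)]
  | succ m ih =>
    intro V _ _ j F h
    have e : fderiv ℝ (divi j F) = divi (j + 1) (numer j F) :=
      funext fun x => (divi_hasFDerivAt j F h x).fderiv
    obtain ⟨C, hC⟩ := ih _ _ (numer_flat j F h)
    exact ⟨C, fun x => by rw [← norm_iteratedFDeriv_fderiv, e]; exact hC x⟩

lemma exists_division {V : Type} [NormedAddCommGroup V] [NormedSpace ℝ V]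
    (F : SchwartzMap E V) (h : FlatAtZero F) :
    ∃ G : SchwartzMap E V, FlatAtZero G ∧ ∀ x, ‖x‖ ^ 2 • G x = F x := by
  refine ⟨⟨divi 1 F, contDiff_infty.2 fun m => divi_contDiff m 1 F h,
    fun k m => divi_decay k m 1 F h⟩, fun m => divi_flat m 1 F h, fun x => ?_⟩
  change ‖x‖ ^ 2 • divi 1 F x = F x
  by_cases hx : x = 0
  · subst hx; simp [h.zero]
  · have hx' : ‖x‖ ≠ 0 := norm_ne_zero_iff.2 hx
    simp [divi, smul_smul, hx']

end division

lemma integrable_poly {n : ℕ} (φ : SchwartzMap (EuclideanSpace ℝ (Fin n)) ℂ)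
    (P : MvPolynomial (Fin n) ℝ) :
    Integrable (fun x : EuclideanSpace ℝ (Fin n) =>
      φ x * ((MvPolynomial.eval (fun i => x i) P : ℝ) : ℂ)) := by
  have hg : Function.HasTemperateGrowth (fun x : EuclideanSpace ℝ (Fin n) =>
      ((MvPolynomial.eval (fun i => x i) P : ℝ) : ℂ)) := by
    induction P using MvPolynomial.induction_on with
    | C a => simp
    | add p q hp hq => simpa [Pi.add_def] using hp.add hq
    | mul_X p i hp =>
      have h : Function.HasTemperateGrowth (fun x : EuclideanSpace ℝ (Fin n) =>
        ((x i : ℝ) : ℂ)) :=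
        (Complex.ofRealCLM.comp (EuclideanSpace.proj (𝕜 := ℝ) i)).hasTemperateGrowth
      simpa [Pi.mul_def] using hp.mul h
  exact (SchwartzMap.bilinLeftCLM (ContinuousLinearMap.mul ℝ ℂ) hg φ).integrable

lemma poly_iff_moments {n : ℕ} (φ : SchwartzMap (EuclideanSpace ℝ (Fin n)) ℂ) :
    ((∀ P : MvPolynomial (Fin n) ℝ,
        ∫ x, φ x * ((MvPolynomial.eval (fun i => x i) P : ℝ) : ℂ) = 0) ↔
      (∀ α : Fin n → ℕ, ∫ x, (∏ i, ((x i : ℝ) : ℂ) ^ α i) * φ x = 0)) := by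
  constructor
  · intro h α
    rw [← h (∏ i, MvPolynomial.X i ^ α i)]
    congr 1
    ext x
    simp [mul_comm]
  · intro h P
    induction P using MvPolynomial.induction_on' with
    | monomial u a =>
      have := h u
      calc _ = ∫ x : EuclideanSpace ℝ (Fin n), (a : ℂ) * ((∏ i, ((x i : ℝ) : ℂ) ^ u i) * φ x) := by
            congr 1
            ext x
            rw [MvPolynomial.eval_monomial, Finsupp.prod_fintype _ _ (by simp)]
            push_cast
            ring
        _ = 0 := by rw [integral_const_mul, this, mul_zero]
    | add p q hp hq =>
      have := integral_add (integrable_poly φ p) (integrable_poly φ q)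
      rw [hp, hq] at this
      simpa [mul_add] using this

lemma iteratedFDeriv_fourier_zero {n : ℕ} (φ : SchwartzMap (EuclideanSpace ℝ (Fin n)) ℂ) (m : ℕ)
    (w : Fin m → EuclideanSpace ℝ (Fin n)) :
    iteratedFDeriv ℝ m (𝓕 ⇑φ) 0 w = (-(2 * Real.pi * Complex.I)) ^ m *
      ∫ x, φ x * ((MvPolynomial.eval (fun i => x i)
        (∏ k, ∑ i, MvPolynomial.C (w k i) * MvPolynomial.X i) : ℝ) : ℂ) := by
  have hi : ∀ k : ℕ, Integrable (fun v : EuclideanSpace ℝ (Fin n) => ‖v‖ ^ k * ‖φ v‖) :=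
    fun k => φ.integrable_pow_mul volume k
  rw [Real.iteratedFDeriv_fourier (N := ⊤) (fun k _ => hi k) φ.continuous.aestronglyMeasurable
    le_top, Real.fourier_eq]
  simp only [inner_zero_right, neg_zero, AddChar.map_zero_eq_one, one_smul]
  rw [ContinuousMultilinearMap.integral_apply]
  · rw [← integral_const_mul]
    congr 1
    ext x
    rw [VectorFourier.fourierPowSMulRight_apply]
    change (-(2 * Real.pi * Complex.I)) ^ m • (∏ i, inner ℝ x (w i)) • φ x = _
    simp [PiLp.inner_apply, mul_comm]
  · refine Integrable.mono' ((hi m).const_mul ((2 * Real.pi * ‖innerSL ℝ (E := EuclideanSpace ℝ (Fin n))‖) ^ m))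
      (φ.continuous.aestronglyMeasurable.fourierPowSMulRight _ m) ?_
    refine Filter.Eventually.of_forall fun v => ?_
    rw [← mul_assoc]
    exact VectorFourier.norm_fourierPowSMulRight_le _ _ _ _

lemma poly_iff_flat {n : ℕ} (φ : SchwartzMap (EuclideanSpace ℝ (Fin n)) ℂ) :
    ((∀ P : MvPolynomial (Fin n) ℝ,
        ∫ x, φ x * ((MvPolynomial.eval (fun i => x i) P : ℝ) : ℂ) = 0) ↔
      (∀ m : ℕ, iteratedFDeriv ℝ m (𝓕 ⇑φ) 0 = 0)) := by
  constructor
  · intro h m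
    ext w
    rw [iteratedFDeriv_fourier_zero, h]
    simp
  · intro h P
    have key : ∀ l : List (Fin n), ∫ x, φ x * ((MvPolynomial.eval (fun i => x i)
        (l.map MvPolynomial.X).prod : ℝ) : ℂ) = 0 := by
      intro l
      have h1 := iteratedFDeriv_fourier_zero φ l.length
        (fun k => EuclideanSpace.single (l.get k) (1 : ℝ))
      rw [h] at h1
      have h2 : (∏ k : Fin l.length, ∑ i, MvPolynomial.C
          ((EuclideanSpace.single (l.get k) (1 : ℝ) : EuclideanSpace ℝ (Fin n)) i) *
            MvPolynomial.X i : MvPolynomial (Fin n) ℝ) = (l.map MvPolynomial.X).prod := by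
        rw [← Fin.prod_univ_fun_getElem]
        refine Finset.prod_congr rfl fun k _ => ?_
        rw [Finset.sum_eq_single (l.get k)]
        · simp
        · intro b _ hb
          have hb' : ¬ b = l[(k : ℕ)] := hb
          simp [hb']
        · simp
      rw [h2] at h1
      have h3 : (-(2 * Real.pi * Complex.I)) ^ l.length ≠ 0 := by
        apply pow_ne_zero; simp [Real.pi_ne_zero]
      simpa [h3] using h1.symm
    have main : ∀ P : MvPolynomial (Fin n) ℝ, ∀ l : List (Fin n),
        ∫ x, φ x * ((MvPolynomial.eval (fun i => x i)
        (P * (l.map MvPolynomial.X).prod) : ℝ) : ℂ) = 0 := by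
      intro P
      induction P using MvPolynomial.induction_on with
      | C a =>
        intro l
        calc _ = ∫ x : EuclideanSpace ℝ (Fin n), (a : ℂ) * (φ x * ((MvPolynomial.eval (fun i => x i)
              (l.map MvPolynomial.X).prod : ℝ) : ℂ)) := by
              congr 1
              ext x
              rw [map_mul, MvPolynomial.eval_C]
              push_cast
              ring
          _ = 0 := by rw [integral_const_mul, key, mul_zero]
      | add p q hp hq =>
        intro l
        have := integral_add (integrable_poly φ (p * (l.map MvPolynomial.X).prod))
          (integrable_poly φ (q * (l.map MvPolynomial.X).prod))
        rw [hp, hq, add_zero] at this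
        rw [← this]
        congr 1
        ext x
        rw [add_mul, map_add]
        push_cast
        ring
      | mul_X p i hp =>
        intro l
        have := hp (i :: l)
        rwa [List.map_cons, List.prod_cons, ← mul_assoc] at this
    simpa using main P []

lemma lap_eq {n : ℕ} (ψ : SchwartzMap (EuclideanSpace ℝ (Fin n)) ℂ) :
    lap ⇑ψ = ⇑(Laplacian.laplacian ψ : SchwartzMap (EuclideanSpace ℝ (Fin n)) ℂ) := by
  ext x
  rw [SchwartzMap.laplacian_apply,
    InnerProductSpace.laplacian_eq_iteratedFDeriv_orthonormalBasis _
      (EuclideanSpace.basisFun (Fin n) ℝ), lap]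
  refine Finset.sum_congr rfl fun i _ => ?_
  congr 1
  ext j
  fin_cases j <;> simp

lemma exists_lap {n : ℕ} (φ : SchwartzMap (EuclideanSpace ℝ (Fin n)) ℂ)
    (h : FlatAtZero (𝓕 ⇑φ)) :
    ∃ ψ : SchwartzMap (EuclideanSpace ℝ (Fin n)) ℂ, FlatAtZero (𝓕 ⇑ψ) ∧ ⇑φ = lap ⇑ψ := by
  obtain ⟨G, hG, hGF⟩ := exists_division (𝓕 φ : SchwartzMap (EuclideanSpace ℝ (Fin n)) ℂ)
    (by rw [SchwartzMap.fourier_coe]; exact h)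
  set c : ℝ := (-(2 * Real.pi) ^ 2)⁻¹ with hc
  have hc0 : -(2 * Real.pi) ^ 2 ≠ 0 := by simp [Real.pi_ne_zero]
  refine ⟨𝓕⁻ (c • G), ?_, ?_⟩
  · rw [← SchwartzMap.fourier_coe, FourierTransform.fourier_fourierInv_eq]
    intro m
    change iteratedFDeriv ℝ m (c • ⇑G) 0 = 0
    rw [iteratedFDeriv_const_smul_apply, hG m, smul_zero]
    exact ContDiff.contDiffAt (SchwartzMap.smooth _ m)
  · rw [lap_eq, SchwartzMap.laplacian_eq_fourierMultiplierCLM,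
      SchwartzMap.fourierMultiplierCLM_apply, FourierTransform.fourier_fourierInv_eq]
    have e : SchwartzMap.smulLeftCLM ℂ (fun x : EuclideanSpace ℝ (Fin n) => ‖x‖ ^ 2) (c • G) =
        c • (𝓕 φ : SchwartzMap (EuclideanSpace ℝ (Fin n)) ℂ) := by
      ext x
      rw [SchwartzMap.smulLeftCLM_apply_apply (by fun_prop)]
      simp only [smul_apply]
      rw [smul_comm, hGF]
    rw [e, FourierTransform.fourierInv_smul, FourierTransform.fourierInv_fourier_eq, smul_smul, hc,
      mul_inv_cancel₀ hc0, one_smul]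

/-- Let `𝒮_∞(ℝⁿ)` be the set of Schwartz functions orthogonal to all polynomials.  A Schwartz
function `φ` belongs to `𝒮_∞(ℝⁿ)` iff all its moments vanish, iff its Fourier transform
vanishes of infinite order at `0`; moreover, every `φ ∈ 𝒮_∞(ℝⁿ)` is, for each `k`, of the
form `φ = Δ^k φ_k` for some Schwartz function `φ_k`. -/
theorem stmt_18 {n : ℕ} (φ : SchwartzMap (EuclideanSpace ℝ (Fin n)) ℂ) :
    ((∀ P : MvPolynomial (Fin n) ℝ,
        ∫ x, φ x * ((MvPolynomial.eval (fun i => x i) P : ℝ) : ℂ) = 0) ↔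
      (∀ α : Fin n → ℕ, ∫ x, (∏ i, ((x i : ℝ) : ℂ) ^ α i) * φ x = 0)) ∧
    ((∀ P : MvPolynomial (Fin n) ℝ,
        ∫ x, φ x * ((MvPolynomial.eval (fun i => x i) P : ℝ) : ℂ) = 0) ↔
      (∀ m : ℕ, iteratedFDeriv ℝ m (𝓕 ⇑φ) 0 = 0)) ∧
    ((∀ P : MvPolynomial (Fin n) ℝ,
        ∫ x, φ x * ((MvPolynomial.eval (fun i => x i) P : ℝ) : ℂ) = 0) →
      ∀ k : ℕ, ∃ ψ : SchwartzMap (EuclideanSpace ℝ (Fin n)) ℂ, ⇑φ = lap^[k] ⇑ψ) := by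
  refine ⟨poly_iff_moments φ, poly_iff_flat φ, fun h k => ?_⟩
  have h' : FlatAtZero (𝓕 ⇑φ) := (poly_iff_flat φ).1 h
  have main : ∃ ψ : SchwartzMap (EuclideanSpace ℝ (Fin n)) ℂ,
      FlatAtZero (𝓕 ⇑ψ) ∧ ⇑φ = lap^[k] ⇑ψ := by
    clear h
    induction k with
    | zero => exact ⟨φ, h', rfl⟩
    | succ k ih =>
      obtain ⟨ψ, hψ, e⟩ := ih
      obtain ⟨χ, hχ, e'⟩ := exists_lap ψ hψ
      exact ⟨χ, hχ, by rw [Function.iterate_succ_apply, ← e', e]⟩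
  obtain ⟨ψ, _, e⟩ := main
  exact ⟨ψ, e⟩
end
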